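/- arXiv:1905.02542 — 13 statements merged into one kernel-verified Lean document; each statement's English description precedes it below -/
import Mathlib

section
/- Let R be a commutative ring and I ⊆ R an ideal with I² = 0. Then the group homomorphism SL_n(R) → SL_n(R/I) induced by the quotient map R → R/I is surjective: every n×n matrix over R/I with determinant 1 lifts to an n×n matrix over R with determinant 1. -/
/-- Let `R` be a commutative ring and `I ⊆ R` an ideal with `I² = 0`.  Then the group
homomorphism `SL_n(R) → SL_n(R/I)` induced by the quotient map `R → R/I` is surjective:
every `n×n` matrix over `R/I` with determinant `1` lifts to an `n×n` matrix over `R`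
with determinant `1`. -/
theorem stmt_2 {R : Type} [CommRing R] (I : Ideal R) (hI : I * I = ⊥) (n : ℕ)
    (gbar : Matrix (Fin n) (Fin n) (R ⧸ I)) (hgbar : gbar.det = 1) :
    ∃ g : Matrix (Fin n) (Fin n) R,
      g.det = 1 ∧ g.map (Ideal.Quotient.mk I) = gbar := by
  obtain ⟨A, rfl⟩ : ∃ A : Matrix (Fin n) (Fin n) R, A.map (Ideal.Quotient.mk I) = gbar :=
    ⟨gbar.map Quotient.out, by ext i j; exact Ideal.Quotient.mk_out _⟩
  cases n with
  | zero => exact ⟨A, Matrix.det_fin_zero, rfl⟩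
  | succ n =>
    have hdet : Ideal.Quotient.mk I A.det = 1 := by
      rw [RingHom.map_det]
      exact hgbar
    have hmem : A.det - 1 ∈ I := by
      rw [← Ideal.Quotient.eq, hdet, map_one]
    have hsq : (A.det - 1) * (A.det - 1) = 0 := by
      rw [← Ideal.mem_bot, ← hI]
      exact Ideal.mul_mem_mul hmem hmem
    refine ⟨A.updateRow 0 ((2 - A.det) • A 0), ?_, ?_⟩
    · rw [Matrix.det_updateRow_smul, Matrix.updateRow_eq_self]
      linear_combination -hsq
    · ext i j
      rcases eq_or_ne i 0 with rfl | hi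
      · simp only [Matrix.map_apply, Matrix.updateRow_self, Pi.smul_apply, smul_eq_mul,
          map_mul, map_sub, hdet, map_ofNat]
        ring
      · simp [Matrix.updateRow_ne hi]
end

section
/- Let R be a commutative ring in which 2 is a unit, and I ⊆ R an ideal with I² = 0. Let J ∈ M_{2n}(R) be the standard symplectic matrix (block form [[0, 1_n], [−1_n, 0]]). Then the group homomorphism Sp_{2n}(R) → Sp_{2n}(R/I) induced by the quotient map R → R/I is surjective: every matrix g over R/I with g J ᵗg = J lifts to a matrix over R satisfying the same identity. -/
/-- Matrices with entries in ideals `I` and `K` with `I * K = ⊥` multiply to zero. -/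
theorem Matrix.mul_eq_zero_of_mem_ideal {l m n R : Type*} [Fintype m] [CommRing R]
    {I K : Ideal R} (hIK : I * K = ⊥) {A : Matrix l m R} {B : Matrix m n R}
    (hA : ∀ i j, A i j ∈ I) (hB : ∀ i j, B i j ∈ K) : A * B = 0 := by
  ext i j
  refine Finset.sum_eq_zero fun k _ => ?_
  have h := Ideal.mul_mem_mul (hA i k) (hB k j)
  rwa [hIK, Ideal.mem_bot] at h

/-- Modulo a square-zero ideal, an isometry of an alternating form whose matrix `J` satisfies
`J² = -1` lifts to an isometry, provided that `2` is invertible. -/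
theorem Matrix.exists_isometry_lift {m R : Type*} [Fintype m] [DecidableEq m] [CommRing R]
    (h2 : IsUnit (2 : R)) {I : Ideal R} (hI : I * I = ⊥) {J : Matrix m m R}
    (hJT : J.transpose = -J) (hJJ : J * J = -1) {gbar : Matrix m m (R ⧸ I)}
    (hgbar : gbar * J.map (Ideal.Quotient.mk I) * gbar.transpose =
      J.map (Ideal.Quotient.mk I)) :
    ∃ g : Matrix m m R, g * J * g.transpose = J ∧ g.map (Ideal.Quotient.mk I) = gbar := by
  obtain ⟨c, hc⟩ := h2.exists_left_inv
  choose s hs using Ideal.Quotient.mk_surjective (I := I)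
  obtain ⟨h, hh⟩ : ∃ h : Matrix m m R, h.map (Ideal.Quotient.mk I) = gbar :=
    ⟨gbar.map s, by ext; simp [hs]⟩
  obtain ⟨E, hE⟩ : ∃ E, E = J - h * J * h.transpose := ⟨_, rfl⟩
  have hEmap : E.map (Ideal.Quotient.mk I) = 0 := by
    rw [hE, Matrix.map_sub _ (map_sub _), Matrix.map_mul, Matrix.map_mul, Matrix.transpose_map,
      hh, hgbar, sub_self]
  have hEI : ∀ i j, E i j ∈ I := fun i j =>
    Ideal.Quotient.eq_zero_iff_mem.mp (congrFun (congrFun hEmap i) j)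
  have hET : E.transpose = -E := by
    simp only [hE, Matrix.transpose_sub, Matrix.transpose_mul, Matrix.transpose_transpose, hJT,
      Matrix.mul_neg, Matrix.neg_mul, Matrix.mul_assoc]
    abel
  -- The correction is `1 + X` with `X * J = c • E = J * Xᵀ`.
  obtain ⟨X, hX⟩ : ∃ X, X = -(c • (E * J)) := ⟨_, rfl⟩
  have hXI : ∀ i j, X i j ∈ I := fun i j => by
    rw [hX]
    exact I.neg_mem (I.mul_mem_left c (I.sum_mem fun k _ => I.mul_mem_right _ (hEI i k)))
  have hXJ : X * J = c • E := by
    simp [hX, Matrix.mul_assoc, hJJ]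
  have hJX : J * X.transpose = c • E := by
    simp [hX, hJT, hET, ← Matrix.mul_assoc, hJJ]
  have hXE : X * E = 0 := Matrix.mul_eq_zero_of_mem_ideal hI hXI hEI
  have hEX : E * X.transpose = 0 :=
    Matrix.mul_eq_zero_of_mem_ideal hI hEI fun i j => hXI j i
  have hXX : X * J * X.transpose = 0 := by
    rw [Matrix.mul_assoc, hJX, Matrix.mul_smul, hXE, smul_zero]
  have hhJ : h * J * h.transpose = J - E := by rw [hE]; abel
  have hcE : c • E + c • E = E := by
    rw [← add_smul, ← mul_two, hc, one_smul]
  refine ⟨(1 + X) * h, ?_, ?_⟩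
  · calc (1 + X) * h * J * ((1 + X) * h).transpose
        = (1 + X) * (h * J * h.transpose) * (1 + X.transpose) := by
          simp only [Matrix.transpose_mul, Matrix.transpose_add, Matrix.transpose_one,
            Matrix.mul_assoc]
      _ = J - E + (X * J + J * X.transpose) + X * J * X.transpose
            - X * E - E * X.transpose - X * E * X.transpose := by
          rw [hhJ]; noncomm_ring
      _ = J := by
          rw [hXX, hXE, hEX, hXJ, hJX, hcE]; simp
  · have hXmap : X.map (Ideal.Quotient.mk I) = 0 := by
      ext i j
      exact Ideal.Quotient.eq_zero_iff_mem.mpr (hXI i j)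
    rw [add_mul, one_mul, Matrix.map_add _ (map_add _), Matrix.map_mul, hXmap, hh, zero_mul,
      add_zero]


/-- Let `R` be a commutative ring in which `2` is a unit, and `I ⊆ R` an ideal with
`I² = 0`.  Let `J ∈ M_{2n}(R)` be the standard symplectic matrix
(block form `[[0, 1ₙ], [−1ₙ, 0]]`).  Then the homomorphism `Sp_{2n}(R) → Sp_{2n}(R/I)`
induced by the quotient map `R → R/I` is surjective: every matrix `g` over `R/I` with
`g J ᵗg = J` lifts to a matrix over `R` satisfying the same identity. -/
theorem stmt_3 {R : Type} [CommRing R] (h2 : IsUnit (2 : R))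
    (I : Ideal R) (hI : I * I = ⊥) (n : ℕ)
    (J : Matrix (Fin n ⊕ Fin n) (Fin n ⊕ Fin n) R)
    (hJ : J = Matrix.fromBlocks 0 1 (-1) 0)
    (gbar : Matrix (Fin n ⊕ Fin n) (Fin n ⊕ Fin n) (R ⧸ I))
    (hgbar : gbar * J.map (Ideal.Quotient.mk I) * gbar.transpose = J.map (Ideal.Quotient.mk I)) :
    ∃ g : Matrix (Fin n ⊕ Fin n) (Fin n ⊕ Fin n) R,
      g * J * g.transpose = J ∧ g.map (Ideal.Quotient.mk I) = gbar := by
  subst hJ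
  refine Matrix.exists_isometry_lift h2 hI ?_ ?_ hgbar
  · simp [Matrix.fromBlocks_transpose, Matrix.fromBlocks_neg]
  · simp [Matrix.fromBlocks_multiply, ← Matrix.fromBlocks_one, Matrix.fromBlocks_neg]
end

section
/- Let R be a nontrivial commutative ring in which 2 is a unit, let S ∈ M_m(R) satisfy ᵗS = S with det S a unit of R, and let I ⊆ R be an ideal with I² = 0. Then the reduction map SO(S)(R) → SO(S̄)(R/I) is surjective, where SO(S)(R) = { g ∈ M_m(R) : g S ᵗg = S and det g = 1 } and S̄ is the reduction of S modulo I: every matrix ḡ over R/I with ḡ S̄ ᵗḡ = S̄ and det ḡ = 1 lifts to such a matrix over R. -/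
/-- Two matrices vanishing modulo a square-zero ideal have product zero. -/
theorem Matrix.mul_eq_zero_of_map_mk_eq_zero {R l m n : Type*} [CommRing R] [Fintype m]
    {I : Ideal R} (hI : I * I = ⊥) {A : Matrix l m R} {B : Matrix m n R}
    (hA : A.map (Ideal.Quotient.mk I) = 0) (hB : B.map (Ideal.Quotient.mk I) = 0) :
    A * B = 0 := by
  ext i j
  rw [Matrix.mul_apply, Matrix.zero_apply]
  refine Finset.sum_eq_zero fun k _ => ?_
  have hAik : A i k ∈ I := Ideal.Quotient.eq_zero_iff_mem.mp (congrFun (congrFun hA i) k)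
  have hBkj : B k j ∈ I := Ideal.Quotient.eq_zero_iff_mem.mp (congrFun (congrFun hB k) j)
  have h := Ideal.mul_mem_mul hAik hBkj
  rwa [hI, Ideal.mem_bot] at h

/-- If `2` is a unit and `I² = 0`, the only square root of `1` congruent to `1` modulo `I`
is `1`. -/
theorem eq_one_of_mul_self_eq_one_of_mk_eq_one {R : Type*} [CommRing R] (h2 : IsUnit (2 : R))
    {I : Ideal R} (hI : I * I = ⊥) {d : R} (hd : d * d = 1)
    (hd1 : Ideal.Quotient.mk I d = 1) : d = 1 := by
  have he : d - 1 ∈ I := by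
    rw [← Ideal.Quotient.eq_zero_iff_mem, map_sub, hd1, map_one, sub_self]
  have hsq := Ideal.mul_mem_mul he he
  rw [hI, Ideal.mem_bot] at hsq
  refine sub_eq_zero.mp (h2.mul_left_cancel ?_)
  linear_combination hd - hsq

/-- Let `R` be a nontrivial commutative ring in which `2` is a unit, let `S ∈ M_m(R)`
satisfy `ᵗS = S` with `det S` a unit of `R`, and let `I ⊆ R` be an ideal with `I² = 0`.
Then the reduction map `SO(S)(R) → SO(S̄)(R/I)` is surjective: every matrix `gbar` over
`R/I` with `gbar S̄ ᵗgbar = S̄` and `det gbar = 1` lifts to such a matrix over `R`. -/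
theorem stmt_4 {R : Type} [CommRing R] [Nontrivial R] (h2 : IsUnit (2 : R))
    (I : Ideal R) (hI : I * I = ⊥) (m : ℕ)
    (S : Matrix (Fin m) (Fin m) R) (hS : S.transpose = S) (hSdet : IsUnit S.det)
    (gbar : Matrix (Fin m) (Fin m) (R ⧸ I))
    (hgbar : gbar * S.map (Ideal.Quotient.mk I) * gbar.transpose = S.map (Ideal.Quotient.mk I))
    (hgbardet : gbar.det = 1) :
    ∃ g : Matrix (Fin m) (Fin m) R,
      g * S * g.transpose = S ∧ g.det = 1 ∧ g.map (Ideal.Quotient.mk I) = gbar := by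
  obtain ⟨c, hc⟩ := h2.exists_left_inv
  obtain ⟨g₀, rfl⟩ : ∃ g₀ : Matrix (Fin m) (Fin m) R, g₀.map (Ideal.Quotient.mk I) = gbar :=
    ⟨gbar.map (Function.surjInv Ideal.Quotient.mk_surjective), by
      ext i j
      exact Function.surjInv_eq Ideal.Quotient.mk_surjective _⟩
  set E := S - g₀ * S * g₀.transpose with hE
  have hEmap : E.map (Ideal.Quotient.mk I) = 0 := by
    rw [hE, Matrix.map_sub _ (map_sub _), Matrix.map_mul, Matrix.map_mul, Matrix.transpose_map,
      hgbar, sub_self]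
  have hEt : E.transpose = E := by
    simp [hE, Matrix.transpose_mul, hS, Matrix.mul_assoc]
  set X := c • (E * S⁻¹) with hX
  have hXmap : X.map (Ideal.Quotient.mk I) = 0 := by
    rw [hX, ← Matrix.smul_mul, Matrix.map_mul]
    have h : (c • E).map (Ideal.Quotient.mk I) = 0 := by
      ext i j
      have hij : Ideal.Quotient.mk I (E i j) = 0 := congrFun (congrFun hEmap i) j
      simp [hij]
    rw [h, Matrix.zero_mul]
  have hXtmap : X.transpose.map (Ideal.Quotient.mk I) = 0 := by
    rw [Matrix.transpose_map, hXmap, Matrix.transpose_zero]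
  have hXS : X * S = c • E := by
    rw [hX, Matrix.smul_mul, Matrix.mul_assoc, Matrix.nonsing_inv_mul _ hSdet, Matrix.mul_one]
  have hSXt : S * X.transpose = c • E := by
    rw [← hEt, ← Matrix.transpose_smul, ← hXS, Matrix.transpose_mul, hS]
  have hXE : X * E = 0 := Matrix.mul_eq_zero_of_map_mk_eq_zero hI hXmap hEmap
  have hEXt : E * X.transpose = 0 := Matrix.mul_eq_zero_of_map_mk_eq_zero hI hEmap hXtmap
  have hcE : c • E + c • E = E := by
    rw [← add_smul, ← mul_two, hc, one_smul]
  have hg : (1 + X) * g₀ * S * ((1 + X) * g₀).transpose = S := by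
    calc (1 + X) * g₀ * S * ((1 + X) * g₀).transpose
        = (1 + X) * (S - E) * (1 + X.transpose) := by
          simp [hE, Matrix.transpose_mul, Matrix.mul_assoc]
      _ = S - E + X * S - X * E + S * X.transpose - E * X.transpose
            + X * S * X.transpose - X * E * X.transpose := by noncomm_ring
      _ = S - E + (c • E + c • E) := by
          rw [hXE, hEXt, hXS, hSXt, Matrix.smul_mul, hEXt]
          simp [add_assoc]
      _ = S := by rw [hcE, sub_add_cancel]
  have hgmap : ((1 + X) * g₀).map (Ideal.Quotient.mk I) = g₀.map (Ideal.Quotient.mk I) := by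
    rw [Matrix.add_mul, Matrix.one_mul, Matrix.map_add _ (map_add _), Matrix.map_mul, hXmap,
      Matrix.zero_mul, add_zero]
  refine ⟨(1 + X) * g₀, hg, eq_one_of_mul_self_eq_one_of_mk_eq_one h2 hI ?_ ?_, hgmap⟩
  · have h := congrArg Matrix.det hg
    rw [Matrix.det_mul, Matrix.det_mul, Matrix.det_transpose] at h
    refine hSdet.mul_left_cancel ?_
    linear_combination h
  · rw [RingHom.map_det, RingHom.mapMatrix_apply, hgmap, hgbardet]
end

section
/- Let R be a commutative ring in which 2 is a unit and t ∈ R an element with t³ = 0. Then for every X ∈ M_n(R), det(1_n + t·X + 2⁻¹·t²·X²) = 1 + t·tr(X) + 2⁻¹·t²·(tr X)². In particular, if tr(X) = 0 then 1_n + t·X + 2⁻¹·t²·X² has determinant 1. -/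
open Polynomial in
/-- If `t ^ 3 = 0`, both `det (1 + t • X)` and `det (1 - t • X)` have a second-order expansion,
with a common quadratic coefficient. -/
theorem exists_det_one_add_smul_of_pow_three_eq_zero {R n : Type*} [CommRing R] [Fintype n]
    [DecidableEq n] {t : R} (ht : t ^ 3 = 0) (X : Matrix n n R) :
    ∃ e : R, (1 + t • X).det = 1 + t * X.trace + t ^ 2 * e ∧
      (1 + (-t) • X).det = 1 - t * X.trace + t ^ 2 * e := by
  rw [Matrix.det_one_add_smul t, Matrix.det_one_add_smul (-t)]
  generalize (1 + (Polynomial.X : R[X]) • X.map C).det.divX.divX = p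
  have hp (r : R) : p.eval r = p.divX.eval r * r + p.coeff 0 := by
    simpa using congrArg (eval r) (divX_mul_X_add p).symm
  refine ⟨p.coeff 0, ?_, ?_⟩
  · linear_combination t ^ 2 * hp t + eval t p.divX * ht
  · linear_combination t ^ 2 * hp (-t) - eval (-t) p.divX * ht

/-- Let `R` be a commutative ring in which `2` is a unit and `t ∈ R` with `t³ = 0`.
Then for every `X ∈ M_n(R)`,
`det(1ₙ + t·X + 2⁻¹·t²·X²) = 1 + t·tr(X) + 2⁻¹·t²·(tr X)²`.
In particular, if `tr(X) = 0` then `1ₙ + t·X + 2⁻¹·t²·X²` has determinant `1`. -/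
theorem stmt_6 {R : Type} [CommRing R] [Invertible (2 : R)] (t : R) (ht : t ^ 3 = 0)
    (n : ℕ) (X : Matrix (Fin n) (Fin n) R) :
    (1 + t • X + (⅟(2 : R) * t ^ 2) • (X * X)).det
        = 1 + t * X.trace + ⅟(2 : R) * t ^ 2 * X.trace ^ 2 ∧
      (X.trace = 0 → (1 + t • X + (⅟(2 : R) * t ^ 2) • (X * X)).det = 1) := by
  have key : (1 + t • X + (⅟(2 : R) * t ^ 2) • (X * X)).det
      = 1 + t * X.trace + ⅟(2 : R) * t ^ 2 * X.trace ^ 2 := by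
    have h_half : ⅟(2 : R) * 2 = 1 := invOf_mul_self 2
    have hdet (c : R) : (1 + (c * t ^ 2) • (X * X)).det = 1 + c * t ^ 2 * (X * X).trace := by
      rw [Matrix.det_one_add_smul]
      generalize Polynomial.eval (c * t ^ 2) (_ : Polynomial R) = q
      linear_combination c ^ 2 * t * q * ht
    obtain ⟨e, h_add, h_sub⟩ := exists_det_one_add_smul_of_pow_three_eq_zero ht X
    have h_prod : (1 + t • X) * (1 + (-t) • X) = 1 + (-1 * t ^ 2) • (X * X) := by
      simp only [mul_add, add_mul, one_mul, mul_one, smul_mul_smul_comm]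
      module
    have h_e := congrArg Matrix.det h_prod
    rw [Matrix.det_mul, h_add, h_sub, hdet] at h_e
    have h_fac : 1 + t • X + (⅟(2 : R) * t ^ 2) • (X * X)
        = (1 + t • X) * (1 + (⅟(2 : R) * t ^ 2) • (X * X)) := by
      have h_zero : t * (⅟(2 : R) * t ^ 2) = 0 := by linear_combination ⅟(2 : R) * ht
      simp only [mul_add, add_mul, one_mul, mul_one, smul_mul_smul_comm, h_zero, zero_smul,
        add_zero]
    rw [h_fac, Matrix.det_mul, h_add, hdet]
    linear_combination ⅟(2 : R) * h_e - t ^ 2 * e * h_half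
      + (⅟(2 : R) * (X * X).trace * (X.trace + t * e) - ⅟(2 : R) * t * e ^ 2) * ht
  exact ⟨key, fun h => by simp [key, h]⟩
end

section
/- Let K be a field of characteristic different from 2 and let J ∈ M_{2n}(K) be the standard symplectic matrix (block form [[0, 1_n], [−1_n, 0]]). If X ∈ M_{2n}(K) satisfies X J + J ᵗX = 0 and tr(X·Y) = 0 for every Y ∈ M_{2n}(K) with Y J + J ᵗY = 0, then X = 0. (Equivalently, the trace form B(X,Y) = tr(XY) is nondegenerate on the Lie algebra sp_{2n}(K).) -/
/-- Let `K` be a field of characteristic `≠ 2` and `J ∈ M_{2n}(K)` the standard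
symplectic matrix `[[0, 1ₙ], [−1ₙ, 0]]`.  If `X ∈ M_{2n}(K)` satisfies
`X J + J ᵗX = 0` and `tr(X·Y) = 0` for every `Y` with `Y J + J ᵗY = 0`, then `X = 0`.
(The trace form is nondegenerate on `sp_{2n}(K)`.) -/
theorem stmt_8 {K : Type} [Field K] (hchar : ringChar K ≠ 2) (n : ℕ)
    (J : Matrix (Fin n ⊕ Fin n) (Fin n ⊕ Fin n) K)
    (hJ : J = Matrix.fromBlocks 0 1 (-1) 0)
    (X : Matrix (Fin n ⊕ Fin n) (Fin n ⊕ Fin n) K)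
    (hX : X * J + J * X.transpose = 0)
    (h : ∀ Y : Matrix (Fin n ⊕ Fin n) (Fin n ⊕ Fin n) K,
      Y * J + J * Y.transpose = 0 → (X * Y).trace = 0) :
    X = 0 := by
  have hJT : J.transpose = -J := by
    subst hJ
    simp [Matrix.fromBlocks_transpose, Matrix.fromBlocks_neg]
  have hJJ : J * J = -1 := by
    subst hJ
    simp [Matrix.fromBlocks_multiply, ← Matrix.fromBlocks_one, Matrix.fromBlocks_neg]
  have hXT : J * X * J = X.transpose := by
    rw [Matrix.mul_assoc, eq_neg_of_add_eq_zero_left hX, Matrix.mul_neg, ← Matrix.mul_assoc, hJJ]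
    simp
  refine Matrix.ext_iff_trace_mul_right.mpr fun Z => ?_
  -- Test against the projection of `Z` to the symplectic Lie algebra.
  have hZ := h (Z + J * Z.transpose * J) <| by
    have h₁ : J * Z.transpose * J * J = -(J * Z.transpose) := by
      rw [Matrix.mul_assoc, hJJ]
      simp
    have h₂ : J * (J * Z.transpose * J).transpose = -(Z * J) := by
      simp only [Matrix.transpose_mul, Matrix.transpose_transpose, hJT, Matrix.neg_mul,
        Matrix.mul_neg, neg_neg]
      rw [← Matrix.mul_assoc, hJJ]
      simp
    rw [Matrix.add_mul, Matrix.transpose_add, Matrix.mul_add, h₁, h₂]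
    abel
  have htr : (X * (J * Z.transpose * J)).trace = (X * Z).trace := by
    rw [← Matrix.mul_assoc, Matrix.trace_mul_comm, ← Matrix.mul_assoc, ← Matrix.mul_assoc, hXT,
      ← Matrix.transpose_mul, Matrix.trace_transpose, Matrix.trace_mul_comm]
  rw [Matrix.mul_add, Matrix.trace_add, htr, ← two_mul] at hZ
  simpa using (mul_eq_zero.mp hZ).resolve_left (Ring.two_ne_zero hchar)
end

section
/- Let K be a field of characteristic different from 2 and let S ∈ M_m(K) be a symmetric invertible matrix (ᵗS = S, det S ≠ 0). If X ∈ M_m(K) satisfies X S + S ᵗX = 0 and tr(X·Y) = 0 for every Y ∈ M_m(K) with Y S + S ᵗY = 0, then X = 0. (Equivalently, the trace form B(X,Y) = tr(XY) is nondegenerate on the Lie algebra so(S)(K).) -/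
/-- Let `K` be a field of characteristic `≠ 2` and `S ∈ M_m(K)` a symmetric invertible
matrix.  If `X ∈ M_m(K)` satisfies `X S + S ᵗX = 0` and `tr(X·Y) = 0` for every `Y`
with `Y S + S ᵗY = 0`, then `X = 0`.  (The trace form is nondegenerate on `so(S)(K)`.) -/
theorem stmt_9 {K : Type} [Field K] (hchar : ringChar K ≠ 2) (m : ℕ)
    (S : Matrix (Fin m) (Fin m) K) (hS : S.transpose = S) (hSdet : S.det ≠ 0)
    (X : Matrix (Fin m) (Fin m) K)
    (hX : X * S + S * X.transpose = 0)
    (h : ∀ Y : Matrix (Fin m) (Fin m) K,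
      Y * S + S * Y.transpose = 0 → (X * Y).trace = 0) :
    X = 0 := by
  have hu : IsUnit S.det := hSdet.isUnit
  have hXS : X * S = -(S * X.transpose) := eq_neg_of_add_eq_zero_left hX
  have htwo : (2 : K) ≠ 0 := Ring.two_ne_zero hchar
  refine Matrix.ext_iff_trace_mul_right.mpr fun Z => ?_
  have hskew : (Z - S * Z.transpose * S⁻¹) * S
      + S * (Z - S * Z.transpose * S⁻¹).transpose = 0 := by
    have hinv : S * (S⁻¹ * (Z * S)) = Z * S := Matrix.mul_nonsing_inv_cancel_left S _ hu
    simp only [Matrix.transpose_sub, Matrix.transpose_mul, Matrix.transpose_transpose,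
      Matrix.transpose_nonsing_inv, hS, Matrix.sub_mul, Matrix.mul_sub, hinv,
      Matrix.nonsing_inv_mul_cancel_right S _ hu]
    abel
  have htrace : (X * (S * Z.transpose * S⁻¹)).trace = -(X * Z).trace := by
    rw [← Matrix.mul_assoc, ← Matrix.mul_assoc, hXS, Matrix.neg_mul, Matrix.neg_mul,
      Matrix.trace_neg, Matrix.trace_mul_comm, ← Matrix.mul_assoc, ← Matrix.mul_assoc,
      Matrix.nonsing_inv_mul S hu, Matrix.one_mul, ← Matrix.transpose_mul,
      Matrix.trace_transpose, Matrix.trace_mul_comm]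
  have h2 := h _ hskew
  rw [Matrix.mul_sub, Matrix.trace_sub, htrace, sub_neg_eq_add, ← two_mul] at h2
  simpa using (mul_eq_zero.mp h2).resolve_left htwo
end

section
/- Let K be a field and β ∈ M_n(K). Then the characteristic polynomial of β equals the minimal polynomial of β if and only if every matrix X ∈ M_n(K) commuting with β (Xβ = βX) is a polynomial in β with coefficients in K; that is, the centralizer of β in M_n(K) equals the K-subalgebra K[β] generated by β. -/
open Polynomial Module

/-- A finitely generated torsion module over a principal ideal domain contains an element which
endomorphisms can move to any other element. -/
theorem Module.exists_forall_exists_end_apply_eq {R M : Type*} [CommRing R] [IsDomain R]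
    [IsPrincipalIdealRing R] [AddCommGroup M] [Module R M] [Module.Finite R M]
    (hM : Module.IsTorsion R M) :
    ∃ v : M, ∀ w : M, ∃ φ : M →ₗ[R] M, φ v = w := by
  classical
  obtain ⟨ι, _, p, -, k, ⟨e⟩⟩ := Module.equiv_directSum_of_isTorsion hM
  let e' : M ≃ₗ[R] Π i, R ⧸ Ideal.span {p i ^ k i} :=
    e.trans (DirectSum.linearEquivFunOnFintype R ι fun i => R ⧸ Ideal.span {p i ^ k i})
  refine ⟨e'.symm 1, fun w =>
    ⟨e'.symm.toLinearMap ∘ₗ LinearMap.mulLeft R (e' w) ∘ₗ e'.toLinearMap, ?_⟩⟩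
  simp

namespace Module.End

variable {K V : Type*} [Field K] [AddCommGroup V] [Module K V]

/-- An endomorphism of the `K[X]`-module attached to `f` commutes with `f`. -/
theorem commute_conj_aevalOf (f : End K V) (φ : AEval' f →ₗ[K[X]] AEval' f) :
    Commute ((AEval'.of f).symm.toLinearMap ∘ₗ φ.restrictScalars K ∘ₗ
      (AEval'.of f).toLinearMap : End K V) f := by
  ext v
  simp only [End.mul_apply, LinearMap.comp_apply, LinearEquiv.coe_coe,
    LinearMap.restrictScalars_apply]
  rw [← AEval'.X_smul_of, map_smul, AEval'.of_symm_X_smul]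

theorem exists_eq_aeval_of_cyclic {f g : End K V} {v : V}
    (hv : ∀ w, ∃ p : K[X], aeval f p v = w) (hg : Commute g f) :
    ∃ p : K[X], g = aeval f p := by
  obtain ⟨p, hp⟩ := hv (g v)
  refine ⟨p, LinearMap.ext fun w => ?_⟩
  obtain ⟨q, rfl⟩ := hv w
  have hgq : Commute g (aeval f q) :=
    Algebra.commute_of_mem_adjoin_singleton_of_commute (aeval_mem_adjoin_singleton K f) hg
  rw [← End.mul_apply, hgq.eq, End.mul_apply, ← hp, ← End.mul_apply, ← End.mul_apply,
    ← map_mul, ← map_mul, mul_comm]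

variable [FiniteDimensional K V]

theorem exists_cyclic_of_forall_commute (f : End K V)
    (h : ∀ g : End K V, Commute g f → ∃ p : K[X], g = aeval f p) :
    ∃ v : V, ∀ w, ∃ p : K[X], aeval f p v = w := by
  obtain ⟨v, hv⟩ := Module.exists_forall_exists_end_apply_eq
    (AEval.isTorsion_of_finiteDimensional K V f)
  refine ⟨(AEval'.of f).symm v, fun w => ?_⟩
  obtain ⟨φ, hφ⟩ := hv (AEval'.of f w)
  obtain ⟨p, hp⟩ := h _ (commute_conj_aevalOf f φ)
  refine ⟨p, ?_⟩
  rw [← hp]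
  simp [hφ]

theorem exists_cyclic_of_charpoly_eq_minpoly (f : End K V) (h : f.charpoly = minpoly K f) :
    ∃ v : V, ∀ w, ∃ p : K[X], aeval f p v = w := by
  obtain ⟨x, hx⟩ := Module.exists_ker_toSpanSingleton_eq_annihilator K[X] (AEval' f)
  rw [AEval.annihilator_eq_ker_aeval] at hx
  set v := (AEval'.of f).symm x
  have hxv (p : K[X]) (hp : aeval f p v = 0) : aeval f p = 0 := by
    have : p ∈ LinearMap.ker (LinearMap.toSpanSingleton K[X] (AEval' f) x) := by
      rw [LinearMap.mem_ker, LinearMap.toSpanSingleton_apply]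
      apply (AEval'.of f).symm.injective
      rw [AEval.of_symm_smul, map_zero]
      exact hp
    rwa [hx] at this
  let ψ : degreeLT K (finrank K V) →ₗ[K] V :=
    LinearMap.applyₗ v ∘ₗ (aeval f).toLinearMap ∘ₗ (degreeLT K (finrank K V)).subtype
  have hψ : Function.Injective ψ := by
    rw [injective_iff_map_eq_zero]
    rintro ⟨p, hp⟩ h0
    ext1
    by_contra hne
    have hle := minpoly.degree_le_of_ne_zero K f hne (hxv p h0)
    rw [← h, degree_eq_natDegree f.charpoly_monic.ne_zero, f.charpoly_natDegree] at hle
    exact (mem_degreeLT.mp hp).not_ge hle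
  have hfin : finrank K (degreeLT K (finrank K V)) = finrank K V := by
    rw [(degreeLTEquiv K _).finrank_eq, finrank_fin_fun]
  have : FiniteDimensional K (degreeLT K (finrank K V)) :=
    (degreeLTEquiv K _).symm.finiteDimensional
  refine ⟨v, fun w => ?_⟩
  obtain ⟨p, hp⟩ := (LinearMap.injective_iff_surjective_of_finrank_eq_finrank hfin).mp hψ w
  exact ⟨p, hp⟩

theorem charpoly_eq_minpoly_of_cyclic {f : End K V} {v : V}
    (hv : ∀ w, ∃ p : K[X], aeval f p v = w) : f.charpoly = minpoly K f := by
  have hm : (minpoly K f).Monic := minpoly.monic (Algebra.IsIntegral.isIntegral f)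
  set d := (minpoly K f).natDegree with hd
  let ψ : degreeLT K d →ₗ[K] V :=
    LinearMap.applyₗ v ∘ₗ (aeval f).toLinearMap ∘ₗ (degreeLT K d).subtype
  have hψ : Function.Surjective ψ := by
    intro w
    obtain ⟨p, rfl⟩ := hv w
    refine ⟨⟨p %ₘ minpoly K f, mem_degreeLT.mpr ?_⟩, ?_⟩
    · rw [hd, ← degree_eq_natDegree hm.ne_zero]
      exact degree_modByMonic_lt p hm
    · change aeval f (p %ₘ minpoly K f) v = aeval f p v
      rw [aeval_modByMonic_eq_self_of_root (minpoly.aeval K f)]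
  have : FiniteDimensional K (degreeLT K d) := (degreeLTEquiv K d).symm.finiteDimensional
  have hle := LinearMap.finrank_le_finrank_of_surjective hψ
  rw [(degreeLTEquiv K d).finrank_eq, finrank_fin_fun] at hle
  refine eq_of_monic_of_dvd_of_natDegree_le hm f.charpoly_monic
    (LinearMap.minpoly_dvd_charpoly f) ?_
  rwa [f.charpoly_natDegree]

/-- The characteristic and minimal polynomials of `f` agree if and only if every endomorphism
commuting with `f` is a polynomial in `f`. -/
theorem charpoly_eq_minpoly_iff_forall_commute (f : End K V) :
    f.charpoly = minpoly K f ↔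
      ∀ g : End K V, Commute g f → ∃ p : K[X], g = aeval f p := by
  constructor
  · intro h g hg
    obtain ⟨v, hv⟩ := exists_cyclic_of_charpoly_eq_minpoly f h
    exact exists_eq_aeval_of_cyclic hv hg
  · intro h
    obtain ⟨v, hv⟩ := exists_cyclic_of_forall_commute f h
    exact charpoly_eq_minpoly_of_cyclic hv

end Module.End



/-- Let `K` be a field and `β ∈ M_n(K)`.  Then the characteristic polynomial of `β`
equals the minimal polynomial of `β` if and only if every matrix `X ∈ M_n(K)` commuting
with `β` is a polynomial in `β` with coefficients in `K`. -/
theorem stmt_12 {K : Type} [Field K] {n : ℕ} (β : Matrix (Fin n) (Fin n) K) :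
    β.charpoly = minpoly K β ↔
      ∀ X : Matrix (Fin n) (Fin n) K, X * β = β * X →
        ∃ p : Polynomial K, X = Polynomial.aeval β p := by
  rw [← Matrix.charpoly_toLin', ← Matrix.minpoly_toLin',
    Module.End.charpoly_eq_minpoly_iff_forall_commute]
  have haeval (p : K[X]) : aeval (Matrix.toLin' β) p = Matrix.toLin' (aeval β p) :=
    aeval_algHom_apply (Matrix.toLinAlgEquiv' (R := K) (n := Fin n)) β p
  simp only [Matrix.toLin'.surjective.forall, commute_iff_eq, End.mul_eq_comp,
    ← Matrix.toLin'_mul, haeval, Matrix.toLin'.injective.eq_iff]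
end

section
/- Let O be a local ring with residue field 𝔽, β ∈ M_n(O), and let β̄ ∈ M_n(𝔽) be the entrywise reduction of β. If the characteristic polynomial of β̄ equals the minimal polynomial of β̄ over 𝔽, then every X ∈ M_n(O) with Xβ = βX is a polynomial in β with coefficients in O; that is, the centralizer { X ∈ M_n(O) : Xβ = βX } equals O[β] = { p(β) : p ∈ O[t] }. -/
theorem Matrix.aeval_sum_monomial_mulVec {R : Type*} [CommRing R] {n k : ℕ}
    (B : Matrix (Fin n) (Fin n) R) (g : Fin k → R) (v : Fin n → R) :
    (Polynomial.aeval B (∑ i : Fin k, Polynomial.monomial (i : ℕ) (g i))).mulVec v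
      = ∑ i : Fin k, g i • (B ^ (i : ℕ)).mulVec v := by
  simp [Polynomial.aeval_monomial, Matrix.sum_mulVec, Matrix.smul_mulVec,
    ← Algebra.smul_def]

/-- A square matrix over a field whose characteristic polynomial is its minimal polynomial has
a cyclic vector. -/
theorem Matrix.exists_linearIndependent_pow_mulVec {K : Type*} [Field K] {n : ℕ}
    (B : Matrix (Fin n) (Fin n) K) (h : B.charpoly = minpoly K B) :
    ∃ v : Fin n → K, LinearIndependent K (fun i : Fin n => (B ^ (i : ℕ)).mulVec v) := by
  obtain ⟨w, hw⟩ := Module.exists_ker_toSpanSingleton_eq_annihilator (R := Polynomial K)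
    (M := Module.AEval' (Matrix.toLin' B))
  obtain ⟨v, rfl⟩ := (Module.AEval'.of (Matrix.toLin' B)).surjective w
  refine ⟨v, ?_⟩
  rw [Fintype.linearIndependent_iff]
  intro g hg
  set p : Polynomial K := ∑ i : Fin n, Polynomial.monomial (i : ℕ) (g i) with hp
  have hpv : p • Module.AEval'.of (Matrix.toLin' B) v = 0 := by
    have haeval : Polynomial.aeval (Matrix.toLin' B) p = Matrix.toLin' (Polynomial.aeval B p) :=
      Polynomial.aeval_algHom_apply (Matrix.toLinAlgEquiv' (R := K) (n := Fin n)) B p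
    change Module.AEval'.of (Matrix.toLin' B) (Polynomial.aeval (Matrix.toLin' B) p v) = 0
    rw [haeval, Matrix.toLin'_apply, hp, Matrix.aeval_sum_monomial_mulVec, hg, map_zero]
  have hmem : p ∈ Module.annihilator (Polynomial K) (Module.AEval' (Matrix.toLin' B)) := by
    rw [← hw]
    simpa using hpv
  rw [← Polynomial.span_minpoly_eq_annihilator, Ideal.mem_span_singleton, Matrix.minpoly_toLin', ← h] at hmem
  have hp0 : p = 0 := by
    refine Polynomial.eq_zero_of_dvd_of_degree_lt hmem ?_
    rw [Matrix.charpoly_degree_eq_dim, Fintype.card_fin]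
    simpa [hp, Polynomial.C_mul_X_pow_eq_monomial] using Polynomial.degree_sum_fin_lt g
  intro i
  have := congrArg (fun q => q.coeff (i : ℕ)) hp0
  simpa [hp, Polynomial.finsetSum_coeff, Polynomial.coeff_monomial, Fin.val_inj] using this

/-- Over a local ring, a square matrix whose reduction has equal characteristic and minimal
polynomials has a vector whose first iterates form a basis. -/
theorem IsLocalRing.exists_isUnit_krylov {O : Type*} [CommRing O] [IsLocalRing O] {n : ℕ}
    (β : Matrix (Fin n) (Fin n) O)
    (h : (β.map (IsLocalRing.residue O)).charpoly
        = minpoly (IsLocalRing.ResidueField O) (β.map (IsLocalRing.residue O))) :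
    ∃ v : Fin n → O, IsUnit (Matrix.of fun i j : Fin n => (β ^ (j : ℕ)).mulVec v i) := by
  obtain ⟨w, hw⟩ := Matrix.exists_linearIndependent_pow_mulVec _ h
  choose v hv using fun i => IsLocalRing.residue_surjective (w i)
  refine ⟨v, ?_⟩
  rw [Matrix.isUnit_iff_isUnit_det]
  refine isUnit_of_map_unit (IsLocalRing.residue O) _ ?_
  rw [RingHom.map_det, ← Matrix.isUnit_iff_isUnit_det, ← Matrix.linearIndependent_cols_iff_isUnit]
  convert hw using 1
  ext j i
  have hvw : IsLocalRing.residue O ∘ v = w := funext hv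
  simp only [Matrix.col_apply, RingHom.mapMatrix_apply, Matrix.map_apply, Matrix.of_apply,
    RingHom.map_mulVec, Matrix.map_pow, hvw]


/-- Let `O` be a local ring with residue field `𝔽`, `β ∈ M_n(O)`, and `β̄ ∈ M_n(𝔽)` the
entrywise reduction of `β`.  If the characteristic polynomial of `β̄` equals the minimal
polynomial of `β̄` over `𝔽`, then every `X ∈ M_n(O)` with `Xβ = βX` is a polynomial in
`β` with coefficients in `O`. -/
theorem stmt_14 {O : Type} [CommRing O] [IsLocalRing O] {n : ℕ}
    (β : Matrix (Fin n) (Fin n) O)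
    (h : (β.map (IsLocalRing.residue O)).charpoly
        = minpoly (IsLocalRing.ResidueField O) (β.map (IsLocalRing.residue O)))
    (X : Matrix (Fin n) (Fin n) O) (hX : X * β = β * X) :
    ∃ p : Polynomial O, X = Polynomial.aeval β p := by
  obtain ⟨v, hv⟩ := IsLocalRing.exists_isUnit_krylov β h
  set V : Matrix (Fin n) (Fin n) O :=
    Matrix.of fun i j : Fin n => (β ^ (j : ℕ)).mulVec v i with hV
  obtain ⟨c, hc⟩ := Matrix.mulVec_surjective_iff_isUnit.mpr hv (X.mulVec v)
  set p : Polynomial O := ∑ i : Fin n, Polynomial.monomial (i : ℕ) (c i) with hp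
  refine ⟨p, hv.mul_left_injective ?_⟩
  have hpv : (Polynomial.aeval β p).mulVec v = X.mulVec v := by
    rw [← hc, hp, Matrix.aeval_sum_monomial_mulVec]
    ext i
    simp [hV, Matrix.mulVec_eq_sum]
  have hcol (Y : Matrix (Fin n) (Fin n) O) (hY : Commute Y β) (i j : Fin n) :
      (Y * V) i j = (β ^ (j : ℕ)).mulVec (Y.mulVec v) i := by
    rw [Matrix.mulVec_mulVec, ← (hY.pow_right _).eq, ← Matrix.mulVec_mulVec]
    rfl
  ext i j
  have hpβ : Commute (Polynomial.aeval β p) β := by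
    simpa using (Polynomial.commute_X p).symm.map (Polynomial.aeval β)
  change (X * V) i j = (Polynomial.aeval β p * V) i j
  rw [hcol X hX, hcol _ hpβ, hpv]
end

section
/- Let O be a local ring with residue field 𝔽, β ∈ M_n(O), and β̄ ∈ M_n(𝔽) the entrywise reduction of β. Then the characteristic polynomial of β̄ equals the minimal polynomial of β̄ if and only if O^n is a cyclic O[β]-module, i.e., there exists v ∈ O^n such that the O-submodule of O^n spanned by { β^k v : k ≥ 0 } is all of O^n. -/
open Polynomial in
/-- The cyclic submodule generated by `v` under `B` is the image of the polynomials under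
`p ↦ p(B) v`. -/
theorem Matrix.mem_span_range_pow_mulVec_iff {R : Type*} [CommRing R] {n : ℕ}
    (B : Matrix (Fin n) (Fin n) R) (v w : Fin n → R) :
    w ∈ Submodule.span R (Set.range fun k : ℕ => (B ^ k).mulVec v) ↔
      ∃ p : R[X], (aeval B p).mulVec v = w := by
  let φ : R[X] →ₗ[R] (Fin n → R) :=
    (Matrix.mulVecBilin R R).flip v ∘ₗ (aeval B).toLinearMap
  have h : (Set.range fun k : ℕ => (B ^ k).mulVec v) =
      φ '' Set.range (fun k : ℕ => (X : R[X]) ^ k) := by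
    rw [← Set.range_comp]
    congr 1
    ext1 k
    simp [φ]
  have htop : Submodule.span R (Set.range fun k : ℕ => (X : R[X]) ^ k) = ⊤ := by
    simpa [coe_basisMonomials, X_pow_eq_monomial] using (basisMonomials R).span_eq
  rw [h, ← Submodule.map_span, htop, Submodule.map_top, LinearMap.mem_range]
  rfl

open Polynomial in
/-- For a square matrix over a field there is a vector which is not killed by any nonzero
polynomial in the matrix. -/
theorem Matrix.exists_aeval_mulVec_eq_zero_imp {K : Type*} [Field K] {n : ℕ}
    (B : Matrix (Fin n) (Fin n) K) :
    ∃ v : Fin n → K, ∀ p : K[X], (aeval B p).mulVec v = 0 → aeval B p = 0 := by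
  obtain ⟨x, hx⟩ := Module.exists_ker_toSpanSingleton_eq_annihilator K[X]
    (Module.AEval' (Matrix.toLin' B))
  obtain ⟨v, rfl⟩ := (Module.AEval'.of _).surjective x
  have key : ∀ p : K[X], aeval (Matrix.toLin' B) p = Matrix.toLin' (aeval B p) := fun p =>
    aeval_algHom_apply (Matrix.toLinAlgEquiv' : Matrix (Fin n) (Fin n) K ≃ₐ[K] _).toAlgHom B p
  refine ⟨v, fun p hp => ?_⟩
  have hmem : p ∈ Module.annihilator K[X] (Module.AEval' (Matrix.toLin' B)) := by
    rw [← hx, LinearMap.mem_ker, LinearMap.toSpanSingleton_apply, ← Module.AEval.of_aeval_smul,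
      key, Module.End.smul_def, Matrix.toLin'_apply, hp, map_zero]
  rw [Module.AEval.annihilator_eq_ker_aeval, RingHom.mem_ker, key] at hmem
  simpa using hmem

open Polynomial in
/-- A square matrix over a field has equal characteristic and minimal polynomials if and only if
it admits a cyclic vector. -/
theorem Matrix.charpoly_eq_minpoly_iff_exists_span_eq_top {K : Type*} [Field K] {n : ℕ}
    (B : Matrix (Fin n) (Fin n) K) :
    B.charpoly = minpoly K B ↔
      ∃ v : Fin n → K, Submodule.span K (Set.range fun k : ℕ => (B ^ k).mulVec v) = ⊤ := by
  have hint : IsIntegral K B := Matrix.isIntegral B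
  let φ (d : ℕ) (v : Fin n → K) : degreeLT K d →ₗ[K] (Fin n → K) :=
    (Matrix.mulVecBilin K K).flip v ∘ₗ (aeval B).toLinearMap ∘ₗ (degreeLT K d).subtype
  have hφ (d v p) : φ d v p = (aeval B p.1).mulVec v := rfl
  have hrank (d : ℕ) : Module.finrank K (degreeLT K d) = d := by
    simp [(degreeLTEquiv K d).finrank_eq]
  have hfin (d : ℕ) : Module.Finite K (degreeLT K d) :=
    Module.Finite.equiv (degreeLTEquiv K d).symm
  constructor
  · intro h
    obtain ⟨v, hv⟩ := B.exists_aeval_mulVec_eq_zero_imp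
    have hinj : Function.Injective (φ n v) := by
      rw [injective_iff_map_eq_zero]
      intro p hp
      have hdvd := minpoly.dvd K B (hv p.1 hp)
      rw [← h] at hdvd
      refine Subtype.ext (eq_zero_of_dvd_of_degree_lt hdvd ?_)
      rw [Matrix.charpoly_degree_eq_dim, Fintype.card_fin]
      exact mem_degreeLT.mp p.2
    have hsurj : Function.Surjective (φ n v) :=
      (LinearMap.injective_iff_surjective_of_finrank_eq_finrank (by simp [hrank])).mp hinj
    refine ⟨v, eq_top_iff.mpr fun w _ => (B.mem_span_range_pow_mulVec_iff v w).mpr ?_⟩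
    obtain ⟨p, hp⟩ := hsurj w
    exact ⟨p.1, hp⟩
  · rintro ⟨v, hv⟩
    have hmonic := minpoly.monic hint
    have hsurj : Function.Surjective (φ (minpoly K B).natDegree v) := by
      intro w
      obtain ⟨p, hp⟩ := (B.mem_span_range_pow_mulVec_iff v w).mp (hv ▸ Submodule.mem_top)
      refine ⟨⟨p %ₘ minpoly K B, mem_degreeLT.mpr ?_⟩, ?_⟩
      · rw [← degree_eq_natDegree hmonic.ne_zero]
        exact degree_modByMonic_lt p hmonic
      · rw [hφ, aeval_modByMonic_eq_self_of_root (minpoly.aeval K B), hp]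
    have hle := LinearMap.finrank_le_finrank_of_surjective hsurj
    rw [hrank, Module.finrank_fin_fun] at hle
    refine eq_of_monic_of_dvd_of_natDegree_le hmonic B.charpoly_monic
      B.minpoly_dvd_charpoly ?_
    rwa [Matrix.charpoly_natDegree_eq_dim, Fintype.card_fin]

/-- **Nakayama's lemma** for a finite free module over a local ring: a set spans if and only if
its reduction spans over the residue field. -/
theorem IsLocalRing.span_image_residue_comp_eq_top_iff {O : Type*} [CommRing O] [IsLocalRing O]
    {n : ℕ} (s : Set (Fin n → O)) :
    Submodule.span (ResidueField O) ((fun w => residue O ∘ w) '' s) = ⊤ ↔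
      Submodule.span O s = ⊤ := by
  let π : (Fin n → O) →ₗ[O] (Fin n → ResidueField O) :=
    (Algebra.linearMap O (ResidueField O)).compLeft (Fin n)
  have hπ : (fun w : Fin n → O => residue O ∘ w) = π := rfl
  have hπs : Function.Surjective π := Function.Surjective.comp_left residue_surjective
  have hker : LinearMap.ker π ≤ maximalIdeal O • (⊤ : Submodule O (Fin n → O)) := by
    intro w hw
    rw [pi_eq_sum_univ' w]
    refine Submodule.sum_mem _ fun i _ => Submodule.smul_mem_smul ?_ Submodule.mem_top
    exact (residue_eq_zero_iff _).mp (congrFun hw i)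
  rw [hπ, ← Submodule.restrictScalars_eq_top_iff O, Submodule.restrictScalars_span O _
    residue_surjective, ← Submodule.map_span]
  constructor
  · intro h
    refine top_le_iff.mp (Submodule.le_of_le_smul_of_le_jacobson_bot Module.Finite.fg_top
      (jacobson_eq_maximalIdeal ⊥ bot_ne_top).ge ?_)
    refine le_trans ?_ (sup_le_sup_left hker _)
    rw [← Submodule.comap_map_eq, h, Submodule.comap_top]
  · intro h
    rw [h, Submodule.map_top, LinearMap.range_eq_top.mpr hπs]

/-- Let `O` be a local ring with residue field `𝔽`, `β ∈ M_n(O)`, and `β̄ ∈ M_n(𝔽)` the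
entrywise reduction of `β`.  Then the characteristic polynomial of `β̄` equals the
minimal polynomial of `β̄` if and only if `Oⁿ` is a cyclic `O[β]`-module, i.e. there is
`v ∈ Oⁿ` such that the `O`-submodule generated by `{β^k v : k ≥ 0}` is all of `Oⁿ`. -/
theorem stmt_15 {O : Type} [CommRing O] [IsLocalRing O] {n : ℕ}
    (β : Matrix (Fin n) (Fin n) O) :
    (β.map (IsLocalRing.residue O)).charpoly
        = minpoly (IsLocalRing.ResidueField O) (β.map (IsLocalRing.residue O)) ↔
      ∃ v : Fin n → O,
        Submodule.span O (Set.range fun k : ℕ => (β ^ k).mulVec v) = ⊤ := by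
  have hred (v : Fin n → O) :
      Submodule.span (IsLocalRing.ResidueField O) (Set.range fun k : ℕ =>
          ((β.map (IsLocalRing.residue O)) ^ k).mulVec (IsLocalRing.residue O ∘ v)) = ⊤ ↔
        Submodule.span O (Set.range fun k : ℕ => (β ^ k).mulVec v) = ⊤ := by
    rw [← IsLocalRing.span_image_residue_comp_eq_top_iff (O := O), ← Set.range_comp]
    refine iff_of_eq (congrArg
      (fun f => Submodule.span (IsLocalRing.ResidueField O) (Set.range f) = ⊤) ?_)
    funext k i
    rw [← Matrix.map_pow, Function.comp_apply, Function.comp_apply, RingHom.map_mulVec]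
  rw [Matrix.charpoly_eq_minpoly_iff_exists_span_eq_top,
    (Function.Surjective.comp_left IsLocalRing.residue_surjective).exists]
  exact exists_congr hred
end

section
/- Let K be a finite group and Z ⊴ K a normal subgroup containing the commutator subgroup [K,K]. Let ψ : Z → ℂˣ be a group homomorphism such that ψ(g h g⁻¹ h⁻¹) = 1 for all g ∈ K and h ∈ Z, and such that the induced pairing D_ψ on K/Z, given by D_ψ(gZ, hZ) = ψ(g h g⁻¹ h⁻¹), is nondegenerate: for every g ∈ K with g ∉ Z there exists h ∈ K with ψ(g h g⁻¹ h⁻¹) ≠ 1. Then there exists a finite-dimensional irreducible complex representation π of K such that π(z) is the scalar ψ(z) for every z ∈ Z; any two such irreducible representations are isomorphic; and (dim π)² equals the index [K : Z]. -/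
namespace Representation

variable {k G V : Type*} [Field k] [Group G] [AddCommGroup V] [Module k V]

theorem isIrreducible_iff_forall_submodule (ρ : Representation k G V) :
    IsIrreducible ρ ↔ Nontrivial V ∧
      ∀ W : Submodule k V, (∀ g : G, ∀ w ∈ W, ρ g w ∈ W) → W = ⊥ ∨ W = ⊤ := by
  constructor
  · intro h
    refine ⟨?_, fun W hW ↦ ?_⟩
    · by_contra hV
      rw [not_nontrivial_iff_subsingleton] at hV
      exact bot_ne_top (α := Subrepresentation ρ)
        (Subrepresentation.toSubmodule_injective (Subsingleton.elim _ _))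
    · refine (eq_bot_or_eq_top (⟨W, hW⟩ : Subrepresentation ρ)).imp ?_ ?_ <;> intro h'
      · exact congrArg Subrepresentation.toSubmodule h'
      · exact congrArg Subrepresentation.toSubmodule h'
  · rintro ⟨_, h⟩
    exact
      { exists_pair_ne := ⟨⊥, ⊤, fun h' ↦
          bot_ne_top (α := Submodule k V) (congrArg Subrepresentation.toSubmodule h')⟩
        eq_bot_or_eq_top := fun σ ↦
          (h σ.toSubmodule fun g w hw ↦ σ.apply_mem_toSubmodule g hw).imp
            (fun h' ↦ Subrepresentation.toSubmodule_injective h')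
            (fun h' ↦ Subrepresentation.toSubmodule_injective h') }

theorem exists_isIrreducible_le [FiniteDimensional k V] (ρ : Representation k G V)
    (U : Submodule k V) (hU : ∀ g : G, ∀ w ∈ U, ρ g w ∈ U) (hU0 : U ≠ ⊥) :
    ∃ σ : Subrepresentation ρ, σ.toSubmodule ≤ U ∧ IsIrreducible σ.toRepresentation := by
  let S : Set (Submodule k V) := {W | W ≤ U ∧ W ≠ ⊥ ∧ ∀ g : G, ∀ w ∈ W, ρ g w ∈ W}
  obtain ⟨W, ⟨hWU, hW0, hW⟩, hmin⟩ :=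
    WellFounded.has_min (wellFounded_lt (α := Submodule k V)) S ⟨U, le_rfl, hU0, hU⟩
  refine ⟨⟨W, hW⟩, hWU, (isIrreducible_iff_forall_submodule _).2
    ⟨Submodule.nontrivial_iff_ne_bot.2 hW0, fun T hT ↦ ?_⟩⟩
  by_contra! hc
  have hle : T.map W.subtype ≤ W := Submodule.map_subtype_le W T
  have hlt : T.map W.subtype < W := by
    refine lt_of_le_of_ne hle fun h ↦ hc.2 ?_
    apply Submodule.map_injective_of_injective W.injective_subtype
    rw [h]
    simp
  refine hmin _ ⟨hle.trans hWU, fun h ↦ hc.1 ?_, ?_⟩ hlt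
  · exact Submodule.map_injective_of_injective W.injective_subtype (by rw [h]; simp)
  · rintro g _ ⟨t, ht, rfl⟩
    exact ⟨_, hT g t ht, rfl⟩

variable (k G) in
/-- The right regular representation on functions, `(g • f) x = f (x * g)`. -/
def rightRegularFun : Representation k G (G → k) where
  toFun g := LinearMap.funLeft k k (· * g)
  map_one' := by ext; simp [LinearMap.funLeft]
  map_mul' g h := by ext; simp [LinearMap.funLeft, mul_assoc]

@[simp]
theorem rightRegularFun_apply (g : G) (f : G → k) (x : G) :
    rightRegularFun k G g f x = f (x * g) := rfl

/-- The functions on `G` that transform under left translation by `Z` through `ψ`. -/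
def leftEquivariant (Z : Subgroup G) (ψ : Z →* kˣ) : Submodule k (G → k) where
  carrier := {f | ∀ (z : Z) (x : G), f (z * x) = ψ z * f x}
  add_mem' hf hg z x := by simp [hf z x, hg z x, mul_add]
  zero_mem' := by simp
  smul_mem' c f hf z x := by simp [hf z x, mul_left_comm]

theorem leftEquivariant_ne_bot (Z : Subgroup G) (ψ : Z →* kˣ) : leftEquivariant Z ψ ≠ ⊥ := by
  classical
  let f : G → k := fun x ↦ if hx : x ∈ Z then ψ ⟨x, hx⟩ else 0
  have hf : f ∈ leftEquivariant Z ψ := by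
    intro z x
    by_cases hx : x ∈ Z
    · have hzx : (z : G) * x ∈ Z := Z.mul_mem z.2 hx
      have : (⟨z * x, hzx⟩ : Z) = z * ⟨x, hx⟩ := rfl
      simp only [f, dif_pos hx, dif_pos hzx, this, map_mul, Units.val_mul]
    · have hzx : (z : G) * x ∉ Z := fun h ↦ hx ((Z.mul_mem_cancel_left z.2).1 h)
      simp [f, hx, hzx]
  refine fun h ↦ ?_
  rw [h, Submodule.mem_bot] at hf
  have h1 : f 1 = 1 := by
    have : (⟨1, Z.one_mem⟩ : Z) = 1 := rfl
    simp [f, this, Z.one_mem]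
  simp [hf] at h1

theorem apply_conj_eq {Z : Subgroup G} [Z.Normal] {ψ : Z →* kˣ}
    (htriv : ∀ (g : G) (h z : Z), (z : G) = g * h * g⁻¹ * (h : G)⁻¹ → ψ z = 1)
    (g : G) (z : Z) : ψ ⟨g * z * g⁻¹, ‹Z.Normal›.conj_mem z z.2 g⟩ = ψ z := by
  rw [← mul_inv_eq_one, ← map_inv, ← map_mul]
  exact htriv g z _ rfl

theorem exists_isIrreducible_of_apply_commutator_eq_one [Finite G] {Z : Subgroup G} [Z.Normal]
    {ψ : Z →* kˣ}
    (htriv : ∀ (g : G) (h z : Z), (z : G) = g * h * g⁻¹ * (h : G)⁻¹ → ψ z = 1) :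
    ∃ σ : Subrepresentation (rightRegularFun k G), IsIrreducible σ.toRepresentation ∧
      ∀ z : Z, σ.toRepresentation (z : G) = (ψ z : k) • LinearMap.id := by
  obtain ⟨σ, hσ, hirr⟩ := exists_isIrreducible_le (rightRegularFun k G) (leftEquivariant Z ψ)
    (fun g f hf z x ↦ by simp only [rightRegularFun_apply, mul_assoc, hf z])
    (leftEquivariant_ne_bot Z ψ)
  refine ⟨σ, hirr, fun z ↦ LinearMap.ext fun f ↦ Subtype.ext (funext fun x ↦ ?_)⟩
  have h := hσ f.2 ⟨x * z * x⁻¹, ‹Z.Normal›.conj_mem z z.2 x⟩ x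
  rw [apply_conj_eq htriv, inv_mul_cancel_right] at h
  exact h

section Character

variable {Z : Subgroup G} {ψ : Z →* kˣ} {ρ : Representation k G V}

theorem character_eq_of_scalar [FiniteDimensional k V]
    (hρ : ∀ z : Z, ρ (z : G) = (ψ z : k) • LinearMap.id) (z : Z) :
    ρ.character z = ψ z * Module.finrank k V := by
  rw [character, hρ, map_smul, LinearMap.trace_id, smul_eq_mul]

theorem character_eq_zero_of_scalar
    (hnondeg : ∀ g : G, g ∉ Z →
      ∃ (h : G) (z : Z), (z : G) = g * h * g⁻¹ * h⁻¹ ∧ ψ z ≠ 1)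
    (hρ : ∀ z : Z, ρ (z : G) = (ψ z : k) • LinearMap.id) {g : G} (hg : g ∉ Z) :
    ρ.character g = 0 := by
  obtain ⟨h, z, hz, hψ⟩ := hnondeg g⁻¹ (by simpa using hg)
  have h1 : h * g * h⁻¹ = g * z := by rw [hz]; group
  have h2 : ρ.character g = ψ z * ρ.character g := by
    conv_lhs => rw [← char_conj ρ g h, h1]
    simp [character, map_mul, hρ, Module.End.mul_eq_comp]
  have h3 : ((ψ z : k) - 1) * ρ.character g = 0 := by rw [sub_mul, ← h2]; ring
  exact (mul_eq_zero.1 h3).resolve_left fun h ↦ hψ (Units.ext (sub_eq_zero.1 h))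

theorem sum_character_mul_character_inv [FiniteDimensional k V] {V' : Type*}
    [AddCommGroup V'] [Module k V'] [FiniteDimensional k V'] [Fintype G]
    {ρ' : Representation k G V'}
    (hnondeg : ∀ g : G, g ∉ Z →
      ∃ (h : G) (z : Z), (z : G) = g * h * g⁻¹ * h⁻¹ ∧ ψ z ≠ 1)
    (hρ : ∀ z : Z, ρ (z : G) = (ψ z : k) • LinearMap.id)
    (hρ' : ∀ z : Z, ρ' (z : G) = (ψ z : k) • LinearMap.id) :
    ∑ g : G, ρ.character g * ρ'.character g⁻¹ =
      Nat.card Z * (Module.finrank k V * Module.finrank k V') := by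
  classical
  have hterm (g : G) : ρ.character g * ρ'.character g⁻¹ =
      if g ∈ Z then (Module.finrank k V * Module.finrank k V' : k) else 0 := by
    split_ifs with hg
    · have h1 := character_eq_of_scalar hρ ⟨g, hg⟩
      have h2 := character_eq_of_scalar hρ' (⟨g, hg⟩ : Z)⁻¹
      simp only [InvMemClass.coe_inv, map_inv] at h1 h2
      rw [h1, h2, mul_mul_mul_comm, Units.mul_inv, one_mul]
    · rw [character_eq_zero_of_scalar hnondeg hρ hg, zero_mul]
  simp_rw [hterm]
  rw [← Finset.sum_filter, Finset.sum_const, nsmul_eq_mul, ← Fintype.card_subtype,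
    Fintype.card_eq_nat_card]

end Character

end Representation

/-- Let `K` be a finite group and `Z ⊴ K` a normal subgroup containing the commutator
subgroup `[K,K]`.  Let `ψ : Z → ℂˣ` be a homomorphism with `ψ(ghg⁻¹h⁻¹) = 1` for all
`g ∈ K`, `h ∈ Z`, and such that the induced pairing on `K/Z`,
`D_ψ(gZ, hZ) = ψ(ghg⁻¹h⁻¹)`, is nondegenerate.  Then there exists a finite-dimensional
irreducible complex representation `π` of `K` on which `Z` acts by the scalar `ψ`; any
two such irreducible representations are isomorphic; and `(dim π)² = [K : Z]`. -/
theorem stmt_16 {K : Type} [Group K] [Fintype K] (Z : Subgroup K) [Z.Normal]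
    (hZ : commutator K ≤ Z) (ψ : Z →* ℂˣ)
    (htriv : ∀ (g : K) (h z : Z), (z : K) = g * h * g⁻¹ * (h : K)⁻¹ → ψ z = 1)
    (hnondeg : ∀ g : K, g ∉ Z →
      ∃ (h : K) (z : Z), (z : K) = g * h * g⁻¹ * h⁻¹ ∧ ψ z ≠ 1) :
    ∃ (V : Type) (_ : AddCommGroup V) (_ : Module ℂ V) (_ : FiniteDimensional ℂ V)
      (π : Representation ℂ K V),
      (Nontrivial V ∧
        (∀ W : Submodule ℂ V, (∀ g : K, ∀ w ∈ W, π g w ∈ W) → W = ⊥ ∨ W = ⊤) ∧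
        (∀ z : Z, π (z : K) = (ψ z : ℂ) • (LinearMap.id : V →ₗ[ℂ] V))) ∧
      (Module.finrank ℂ V) ^ 2 = Z.index ∧
      (∀ (V' : Type) (_ : AddCommGroup V') (_ : Module ℂ V') (_ : FiniteDimensional ℂ V')
        (π' : Representation ℂ K V'),
        (Nontrivial V' ∧
          (∀ W : Submodule ℂ V', (∀ g : K, ∀ w ∈ W, π' g w ∈ W) → W = ⊥ ∨ W = ⊤) ∧
          (∀ z : Z, π' (z : K) = (ψ z : ℂ) • (LinearMap.id : V' →ₗ[ℂ] V'))) →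
        ∃ e : V ≃ₗ[ℂ] V', ∀ (g : K) (v : V), e (π g v) = π' g (e v)) := by
  have hcard : (Nat.card K : ℂ) ≠ 0 := Nat.cast_ne_zero.2 Nat.card_pos.ne'
  have hcardZ : (Nat.card Z : ℂ) ≠ 0 := Nat.cast_ne_zero.2 Nat.card_pos.ne'
  have := invertibleOfNonzero hcard
  obtain ⟨σ, hirr, hσ⟩ :=
    Representation.exists_isIrreducible_of_apply_commutator_eq_one htriv
  have hirr' := (Representation.isIrreducible_iff_forall_submodule _).1 hirr
  refine ⟨σ.toSubmodule, inferInstance, inferInstance, inferInstance, σ.toRepresentation,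
    ⟨hirr'.1, hirr'.2, hσ⟩, ?_, ?_⟩
  · have h := Representation.char_orthonormal σ.toRepresentation σ.toRepresentation
    rw [if_pos ⟨.refl _⟩, Representation.sum_character_mul_character_inv hnondeg hσ hσ,
      inv_mul_eq_one₀ hcard, ← Z.card_mul_index, Nat.cast_mul] at h
    have h' := mul_left_cancel₀ hcardZ h
    rw [sq]
    exact_mod_cast h'.symm
  · rintro V' _ _ _ π' ⟨hV', hsub, hπ'⟩
    have hirrV' := (Representation.isIrreducible_iff_forall_submodule π').2 ⟨hV', hsub⟩
    have h := Representation.char_orthonormal π' σ.toRepresentation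
    rw [Representation.sum_character_mul_character_inv hnondeg hπ' hσ] at h
    have := hirr'.1
    have hV : (Module.finrank ℂ σ.toSubmodule : ℂ) ≠ 0 :=
      Nat.cast_ne_zero.2 Module.finrank_pos.ne'
    have hVpos : (Module.finrank ℂ V' : ℂ) ≠ 0 := Nat.cast_ne_zero.2 Module.finrank_pos.ne'
    split_ifs at h with hne
    · obtain ⟨φ⟩ := hne
      exact ⟨φ.toLinearEquiv, fun g v ↦ LinearMap.congr_fun (φ.isIntertwining' g) v⟩
    · simp_all
end

section
/- Let G be a finite abelian group, N ≤ G a subgroup, Q = G/N the quotient group with projection π : G → Q. Let c : Q × Q → ℂˣ satisfy the 2-cocycle identity c(x,y)·c(xy,z) = c(y,z)·c(x,yz) for all x,y,z ∈ Q. If the inflation of c to G is a coboundary — i.e., there exists b : G → ℂˣ with c(π(g), π(h)) = b(g)·b(h)·b(gh)⁻¹ for all g,h ∈ G — then c itself is a coboundary: there exists a : Q → ℂˣ with c(x,y) = a(x)·a(y)·a(xy)⁻¹ for all x,y ∈ Q. (Equivalently, the inflation map H²(Q, ℂˣ) → H²(G, ℂˣ) with trivial coefficients is injective.) -/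
/-- Let `G` be a finite abelian group, `N ≤ G` a subgroup, `Q = G/N`.  Let
`c : Q × Q → ℂˣ` be a 2-cocycle.  If the inflation of `c` to `G` is a coboundary, then
`c` itself is a coboundary.  (The inflation map `H²(Q, ℂˣ) → H²(G, ℂˣ)` with trivial
coefficients is injective.) -/
theorem stmt_17 {G : Type} [CommGroup G] [Fintype G] (N : Subgroup G)
    (c : G ⧸ N → G ⧸ N → ℂˣ)
    (hcoc : ∀ x y z : G ⧸ N, c x y * c (x * y) z = c y z * c x (y * z))
    (b : G → ℂˣ)
    (hb : ∀ g h : G, c (QuotientGroup.mk g) (QuotientGroup.mk h)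
        = b g * b h * (b (g * h))⁻¹) :
    ∃ a : G ⧸ N → ℂˣ, ∀ x y : G ⧸ N, c x y = a x * a y * (a (x * y))⁻¹ := by
  have hc1 (x : G ⧸ N) : c x 1 = c 1 1 := by simpa using hcoc x 1 1
  have hmul (g h : G) : b g * b h = c g h * b (g * h) := by rw [hb]; simp
  have hN (g : G) (n : N) : b g * b n = c 1 1 * b (g * n) := by
    rw [hmul, (QuotientGroup.eq_one_iff (n : G)).2 n.2, hc1]
  let χ : N →* ℂˣ := MonoidHom.mk' (fun n ↦ b n * (c 1 1)⁻¹) fun m n ↦ by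
    rw [mul_mul_mul_comm, hN, Subgroup.coe_mul]
    simp [mul_comm]
  obtain ⟨ψ, hψ⟩ := MonoidHom.domRestrict_surjective ℂ N χ
  have hψN (n : N) : ψ n = b n * (c 1 1)⁻¹ := DFunLike.congr_fun hψ n
  have hinv (g : G) (n : N) : b (g * n) * (ψ (g * n))⁻¹ = b g * (ψ g)⁻¹ := by
    have hbn : b (g * n) = b g * ψ n := by
      rw [hψN, ← mul_assoc, hN, mul_right_comm, mul_inv_cancel, one_mul]
    rw [hbn, map_mul, mul_inv, mul_comm (ψ g)⁻¹, ← mul_assoc, mul_inv_cancel_right]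
  have hout (g : G) : b (g : G ⧸ N).out * (ψ (g : G ⧸ N).out)⁻¹ = b g * (ψ g)⁻¹ := by
    obtain ⟨n, hn⟩ := QuotientGroup.mk_out_eq_mul N g
    rw [hn, hinv]
  refine ⟨fun x ↦ b x.out * (ψ x.out)⁻¹, fun x y ↦ ?_⟩
  induction x using QuotientGroup.induction_on with | H g =>
  induction y using QuotientGroup.induction_on with | H h =>
  rw [← QuotientGroup.mk_mul]
  simp only [hout]
  rw [hb, map_mul, mul_inv, mul_mul_mul_comm (b g), ← mul_inv (ψ g), mul_mul_mul_comm,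
    mul_inv_cancel, mul_one]
end

section
/- Let G be a finite group and K ⊴ G a normal subgroup such that the quotient G/K is abelian. Let χ : G → ℂˣ be a group homomorphism and set ψ = χ|_K. Then every finite-dimensional irreducible complex representation σ of G for which there exists a nonzero vector v with σ(k)v = ψ(k)·v for all k ∈ K is one-dimensional. -/
/-- If all operators commute and the representation has no proper nonzero invariant subspace, then
it is one-dimensional. -/
theorem Representation.finrank_eq_one_of_commute {G k V : Type*} [Group G] [Field k]
    [IsAlgClosed k] [AddCommGroup V] [Module k V] [FiniteDimensional k V] [Nontrivial V]
    (σ : Representation k G V) (hcomm : ∀ a b : G, Commute (σ a) (σ b))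
    (hirr : ∀ W : Submodule k V, (∀ g : G, ∀ w ∈ W, σ g w ∈ W) → W = ⊥ ∨ W = ⊤) :
    Module.finrank k V = 1 := by
  have hscalar (g : G) : ∃ c : k, ∀ w, σ g w = c • w := by
    obtain ⟨c, hc⟩ := Module.End.exists_eigenvalue (σ g)
    refine ⟨c, fun w => ?_⟩
    have htop : Module.End.eigenspace (σ g) c = ⊤ :=
      (hirr _ fun a w hw =>
        Module.End.mapsTo_genEigenspace_of_comm (hcomm g a) c 1 hw).resolve_left hc
    exact Module.End.mem_eigenspace_iff.1 (htop ▸ Submodule.mem_top)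
  obtain ⟨v, hv⟩ := exists_ne (0 : V)
  have hspan : Submodule.span k {v} = ⊤ := by
    refine (hirr _ fun g w hw => ?_).resolve_left (by simpa using hv)
    obtain ⟨c, hc⟩ := hscalar g
    exact hc w ▸ Submodule.smul_mem _ c hw
  rw [← finrank_top k V, ← hspan, finrank_span_singleton hv]

/-- The subspace on which the normal subgroup `K` acts through the character `χ` of `G`. -/
def Representation.charSubspace {G k V : Type*} [Group G] [Field k] [AddCommGroup V] [Module k V]
    (σ : Representation k G V) (K : Subgroup G) (χ : G →* kˣ) : Submodule k V :=
  ⨅ x : K, LinearMap.ker (σ (x : G) - (χ (x : G) : k) • LinearMap.id)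

theorem Representation.mem_charSubspace {G k V : Type*} [Group G] [Field k] [AddCommGroup V]
    [Module k V] {σ : Representation k G V} {K : Subgroup G} {χ : G →* kˣ} {w : V} :
    w ∈ σ.charSubspace K χ ↔ ∀ x ∈ K, σ x w = (χ x : k) • w := by
  simp [charSubspace, sub_eq_zero]

theorem Representation.apply_mem_charSubspace {G k V : Type*} [Group G] [Field k] [AddCommGroup V]
    [Module k V] {σ : Representation k G V} {K : Subgroup G} [hK : K.Normal] {χ : G →* kˣ}
    (g : G) {w : V} (hw : w ∈ σ.charSubspace K χ) : σ g w ∈ σ.charSubspace K χ := by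
  rw [mem_charSubspace] at hw ⊢
  intro x hx
  have h := hw (g⁻¹ * x * g) (by simpa using hK.conj_mem x hx g⁻¹)
  have hχ : χ (g⁻¹ * x * g) = χ x := by simp [mul_right_comm]
  rw [hχ] at h
  rw [← map_smul, ← h, ← Module.End.mul_apply, ← Module.End.mul_apply, ← map_mul, ← map_mul]
  group

/-- Let `G` be a finite group and `K ⊴ G` a normal subgroup with `G/K` abelian.  Let
`χ : G → ℂˣ` be a homomorphism and `ψ = χ|_K`.  Then every finite-dimensional
irreducible complex representation `σ` of `G` admitting a nonzero vector `v` with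
`σ(k)v = ψ(k)·v` for all `k ∈ K` is one-dimensional. -/
theorem stmt_18 {G : Type} [Group G] [Fintype G] (K : Subgroup G) [K.Normal]
    (hab : ∀ a b : G ⧸ K, a * b = b * a)
    (χ : G →* ℂˣ)
    (V : Type) [AddCommGroup V] [Module ℂ V] [FiniteDimensional ℂ V]
    (σ : Representation ℂ G V)
    (hnontriv : Nontrivial V)
    (hirr : ∀ W : Submodule ℂ V, (∀ g : G, ∀ w ∈ W, σ g w ∈ W) → W = ⊥ ∨ W = ⊤)
    (v : V) (hv : v ≠ 0)
    (hvK : ∀ k : K, σ (k : G) v = (χ (k : G) : ℂ) • v) :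
    Module.finrank ℂ V = 1 := by
  have htop : σ.charSubspace K χ = ⊤ := by
    refine (hirr _ fun g w hw =>
      Representation.apply_mem_charSubspace g hw).resolve_left fun h => ?_
    have hmem : v ∈ σ.charSubspace K χ :=
      Representation.mem_charSubspace.2 fun x hx => hvK ⟨x, hx⟩
    exact hv (by simpa [h] using hmem)
  have hK (x : G) (hx : x ∈ K) (w : V) : σ x w = (χ x : ℂ) • w :=
    Representation.mem_charSubspace.1 (htop ▸ Submodule.mem_top) x hx
  refine Representation.finrank_eq_one_of_commute σ (fun a b => LinearMap.ext fun w => ?_) hirr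
  have hmem : (b * a)⁻¹ * (a * b) ∈ K := QuotientGroup.eq.1 (hab b a)
  have hχ : χ ((b * a)⁻¹ * (a * b)) = 1 := by simp [mul_comm (χ a)]
  have hfix : σ ((b * a)⁻¹ * (a * b)) w = w := by
    rw [hK _ hmem w, hχ, Units.val_one, one_smul]
  calc (σ a * σ b) w = σ (b * a * ((b * a)⁻¹ * (a * b))) w := by rw [mul_inv_cancel_left, map_mul]
    _ = (σ b * σ a) w := by rw [map_mul σ (b * a), Module.End.mul_apply, hfix, map_mul]
end

section
/- Let 𝔽 be a finite field of odd characteristic, ψ₀ : (𝔽,+) → ℂˣ a nontrivial additive character, and 𝔤 ⊆ M_n(𝔽) an 𝔽-subspace closed under the bracket [X,Y] = XY − YX on which the trace form B(X,Y) = tr(XY) is nondegenerate. Fix β ∈ 𝔤 with centralizer 𝔤_β = { X ∈ 𝔤 : Xβ = βX } strictly contained in 𝔤, and let V = 𝔤/𝔤_β with the (well-defined, nondegenerate, alternating) form ⟨X+𝔤_β, Y+𝔤_β⟩ = tr([X,Y]β). Let Γ = { g ∈ GL_n(𝔽) : g𝔤g⁻¹ = 𝔤 and gYg⁻¹ = Y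 for all Y ∈ 𝔤_β }, and for g ∈ Γ let σ_g : V → V be induced by X ↦ g⁻¹Xg. Let ρ : (𝔤_β,+) → ℂˣ be a group homomorphism. Suppose s, s′ : V → 𝔤 are two 𝔽-linear sections of the quotient map 𝔤 → V, and suppose v, v′ : Γ → V satisfy, for all u ∈ V and g ∈ Γ, ρ(g⁻¹ s(u) g − s(σ_g u)) = ψ₀(⟨u, v(g)⟩) and ρ(g⁻¹ s′(u) g − s′(σ_g u)) = ψ₀(⟨u, v′(g)⟩). Define c(g,h) = ψ₀(2⁻¹⟨v(g), v(gh)⟩) and c′(g,h) = ψ₀(2⁻¹⟨v′(g), v′(gh)⟩). Then c and c′ are cohomologous: there exists α : Γ → ℂˣ such that c′(g,h) = c(g,h)·α(g)·α(h)·α(gh)⁻¹ for all g, h ∈ Γ. -/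
section AddCharPairing

variable {F V : Type*} [Field F] [AddCommGroup V] [Module F V]

/-- A nondegenerate bilinear form composed with a nontrivial additive character still
separates points. -/
theorem eq_of_addChar_bilin_eq {M : Type*} [CommMonoid M] {ψ : AddChar F M}
    (hψ : ∃ x, ψ x ≠ 1) (B : V →ₗ[F] V →ₗ[F] F) (hB : ∀ x, (∀ u, B u x = 0) → x = 0)
    {x y : V} (h : ∀ u, ψ (B u x) = ψ (B u y)) : x = y := by
  rw [← sub_eq_zero]
  refine hB _ fun u => ?_
  by_contra hne
  obtain ⟨a, ha⟩ := hψ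
  have hu := h ((a / B u (x - y)) • u)
  have hsplit : B ((a / B u (x - y)) • u) x = a + B ((a / B u (x - y)) • u) y := by
    have : B ((a / B u (x - y)) • u) (x - y) = a := by
      simp only [map_smul, LinearMap.smul_apply, smul_eq_mul]
      exact div_mul_cancel₀ _ hne
    rw [map_sub] at this
    exact sub_eq_iff_eq_add.mp this
  rw [hsplit, AddChar.map_add_eq_mul] at hu
  refine ha ?_
  have hinv : ψ (B ((a / B u (x - y)) • u) y) * ψ (-B ((a / B u (x - y)) • u) y) = 1 := by
    rw [← AddChar.map_add_eq_mul, add_neg_cancel, AddChar.map_zero_eq_one]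
  calc ψ a = ψ a * ψ (B ((a / B u (x - y)) • u) y) * ψ (-B ((a / B u (x - y)) • u) y) := by
        rw [mul_assoc, hinv, mul_one]
    _ = 1 := by rw [hu, hinv]

/-- Every character of a finite vector space with a nondegenerate bilinear form `B` has
the shape `u ↦ ψ (B u w)`. -/
theorem exists_addChar_eq_bilin [Finite V] {ψ : AddChar F ℂˣ}
    (hψ : ∃ x, ψ x ≠ 1) (B : V →ₗ[F] V →ₗ[F] F) (hB : ∀ x, (∀ u, B u x = 0) → x = 0)
    (χ : AddChar V ℂˣ) : ∃ w, ∀ u, χ u = ψ (B u w) := by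
  have := Fintype.ofFinite V
  let Φ : V → AddChar V ℂ := fun w =>
    (Units.coeHom ℂ).compAddChar (ψ.compAddMonoidHom (B.flip w).toAddMonoidHom)
  have hΦ : ∀ w u, Φ w u = (ψ (B u w) : ℂ) := fun _ _ => rfl
  have hinj : Function.Injective Φ := fun x y hxy =>
    eq_of_addChar_bilin_eq hψ B hB fun u => Units.ext <| by
      rw [← hΦ, ← hΦ, hxy]
  have hbij : Function.Bijective Φ :=
    (Fintype.bijective_iff_injective_and_card Φ).2 ⟨hinj, AddChar.card_eq.symm⟩
  obtain ⟨w, hw⟩ := hbij.2 ((Units.coeHom ℂ).compAddChar χ)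
  refine ⟨w, fun u => Units.ext ?_⟩
  rw [← hΦ, hw]
  rfl

/-- The change of `B (v g) (v (g * h))` under the modification of the cocycle `v` by the
coboundary of `w`. Here `p, q, r` are the values of `v` at `g, h, g * h`, and `z, z', w₀`
are the images of `q, q', w` under the isometry attached to `g`. -/
theorem bilin_cocycle_change (B : V →ₗ[F] V →ₗ[F] F) (hB : ∀ x y, B x y = -B y x)
    (hB₀ : ∀ x, B x x = 0)
    {p q r p' q' r' z z' w w₀ : V} (hr : r = p + z) (hr' : r' = p' + z')
    (hp' : p' = p + w - w₀)
    (hqw : B z w₀ = B q w) (hq'w : B z' w₀ = B q' w) (hqq' : B z z' = B q q') :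
    B p' r' = B p r + (B p w - B w p' - B p p') + (B q w - B w q' - B q q')
      - (B r w - B w r' - B r r') := by
  subst hr hr' hp'
  simp only [map_add, map_sub, LinearMap.add_apply, LinearMap.sub_apply, hB₀]
  rw [hB w₀ z', hq'w, hqw, hqq', hB w q', hB z p, hB w₀ p]
  linear_combination hB w p - hB w₀ w

end AddCharPairing

/-- Independence, up to coboundary, of the Schur multiplier `c_{β,ρ}` from the chosen
linear section: with `𝔽` a finite field of odd characteristic, `ψ₀` a nontrivial
additive character, `𝔤 ⊆ M_n(𝔽)` a subspace closed under bracket on which the trace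
form is nondegenerate, `β ∈ 𝔤` with centralizer `𝔤_β ⊊ 𝔤`, `V = 𝔤/𝔤_β` with symplectic
form `ω`, `Γ` the subgroup of `GL_n(𝔽)` normalizing `𝔤` and centralizing `𝔤_β`,
`ρ` a character of `(𝔤_β,+)`, and `s, s′` two linear sections with associated maps
`v, v′ : Γ → V`, the 2-cocycles `c(g,h) = ψ₀(2⁻¹ ω(v g, v (gh)))` and
`c′(g,h) = ψ₀(2⁻¹ ω(v′ g, v′ (gh)))` are cohomologous. -/
theorem stmt_19 {𝔽 : Type} [Field 𝔽] [Fintype 𝔽] (hchar : ringChar 𝔽 ≠ 2)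
    (ψ₀ : AddChar 𝔽 ℂˣ) (hψ₀ : ∃ x : 𝔽, ψ₀ x ≠ 1)
    {n : ℕ}
    (𝔤 : Submodule 𝔽 (Matrix (Fin n) (Fin n) 𝔽))
    (hbracket : ∀ X ∈ 𝔤, ∀ Y ∈ 𝔤, X * Y - Y * X ∈ 𝔤)
    (hnondeg : ∀ X ∈ 𝔤, (∀ Y ∈ 𝔤, (X * Y).trace = 0) → X = 0)
    (β : Matrix (Fin n) (Fin n) 𝔽) (hβ : β ∈ 𝔤)
    (gβ : Submodule 𝔽 ↥𝔤)
    (hgβ : ∀ X : ↥𝔤, X ∈ gβ ↔ (X : Matrix (Fin n) (Fin n) 𝔽) * β = β * X)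
    (hproper : gβ ≠ ⊤)
    (ω : (↥𝔤 ⧸ gβ) → (↥𝔤 ⧸ gβ) → 𝔽)
    (hω : ∀ X Y : ↥𝔤,
      ω (Submodule.Quotient.mk X) (Submodule.Quotient.mk Y)
        = (((X : Matrix (Fin n) (Fin n) 𝔽) * Y - (Y : Matrix (Fin n) (Fin n) 𝔽) * X)
            * β).trace)
    (Γ : Set (Matrix (Fin n) (Fin n) 𝔽)ˣ)
    (hΓ : ∀ g : (Matrix (Fin n) (Fin n) 𝔽)ˣ, g ∈ Γ ↔
      ((∀ X : Matrix (Fin n) (Fin n) 𝔽, X ∈ 𝔤 ↔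
          (g : Matrix (Fin n) (Fin n) 𝔽) * X * (↑g⁻¹ : Matrix (Fin n) (Fin n) 𝔽) ∈ 𝔤) ∧
        (∀ Y : ↥𝔤, Y ∈ gβ →
          (g : Matrix (Fin n) (Fin n) 𝔽) * Y * (↑g⁻¹ : Matrix (Fin n) (Fin n) 𝔽) = Y)))
    (σ : (Matrix (Fin n) (Fin n) 𝔽)ˣ → (↥𝔤 ⧸ gβ) → (↥𝔤 ⧸ gβ))
    (hσ : ∀ g ∈ Γ, ∀ X Y : ↥𝔤,
      (Y : Matrix (Fin n) (Fin n) 𝔽)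
          = (↑g⁻¹ : Matrix (Fin n) (Fin n) 𝔽) * X * g →
      σ g (Submodule.Quotient.mk X) = Submodule.Quotient.mk Y)
    (ρ : AddChar ↥gβ ℂˣ)
    (s s' : (↥𝔤 ⧸ gβ) →ₗ[𝔽] ↥𝔤)
    (hs : ∀ u : ↥𝔤 ⧸ gβ, (Submodule.Quotient.mk (s u) : ↥𝔤 ⧸ gβ) = u)
    (hs' : ∀ u : ↥𝔤 ⧸ gβ, (Submodule.Quotient.mk (s' u) : ↥𝔤 ⧸ gβ) = u)
    (v v' : (Matrix (Fin n) (Fin n) 𝔽)ˣ → (↥𝔤 ⧸ gβ))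
    (hv : ∀ g ∈ Γ, ∀ (u : ↥𝔤 ⧸ gβ) (d : ↥gβ),
      ((d : ↥𝔤) : Matrix (Fin n) (Fin n) 𝔽)
          = (↑g⁻¹ : Matrix (Fin n) (Fin n) 𝔽) * (s u) * g
            - ((s (σ g u) : ↥𝔤) : Matrix (Fin n) (Fin n) 𝔽) →
      ρ d = ψ₀ (ω u (v g)))
    (hv' : ∀ g ∈ Γ, ∀ (u : ↥𝔤 ⧸ gβ) (d : ↥gβ),
      ((d : ↥𝔤) : Matrix (Fin n) (Fin n) 𝔽)
          = (↑g⁻¹ : Matrix (Fin n) (Fin n) 𝔽) * (s' u) * g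
            - ((s' (σ g u) : ↥𝔤) : Matrix (Fin n) (Fin n) 𝔽) →
      ρ d = ψ₀ (ω u (v' g))) :
    ∃ α : (Matrix (Fin n) (Fin n) 𝔽)ˣ → ℂˣ, ∀ g ∈ Γ, ∀ h ∈ Γ,
      ψ₀ ((2 : 𝔽)⁻¹ * ω (v' g) (v' (g * h)))
        = ψ₀ ((2 : 𝔽)⁻¹ * ω (v g) (v (g * h))) * α g * α h * (α (g * h))⁻¹ := by
  have hconj : ∀ g ∈ Γ, ∀ X : ↥𝔤, ∃ Y : ↥𝔤, (Y : Matrix (Fin n) (Fin n) 𝔽)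
      = (↑g⁻¹ : Matrix (Fin n) (Fin n) 𝔽) * X * g := fun g hg X =>
    ⟨⟨_, (((hΓ g).1 hg).1 _).2 (by simp [mul_assoc])⟩, rfl⟩
  have hconj_surj : ∀ g ∈ Γ, ∀ Y : ↥𝔤, ∃ X : ↥𝔤, (Y : Matrix (Fin n) (Fin n) 𝔽)
      = (↑g⁻¹ : Matrix (Fin n) (Fin n) 𝔽) * X * g := fun g hg Y =>
    ⟨⟨_, (((hΓ g).1 hg).1 Y).1 Y.2⟩, by simp [mul_assoc]⟩
  have hfix : ∀ g ∈ Γ, ∀ D : ↥𝔤, D ∈ gβ →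
      (↑g⁻¹ : Matrix (Fin n) (Fin n) 𝔽) * D * g = D := by
    intro g hg D hD
    conv_lhs => rw [← ((hΓ g).1 hg).2 D hD]
    simp [mul_assoc]
  have hmul : ∀ g ∈ Γ, ∀ h ∈ Γ, g * h ∈ Γ := by
    intro g hg h hh
    refine (hΓ _).2 ⟨fun X => ?_, fun Y hY => ?_⟩
    · rw [((hΓ h).1 hh).1 X, ((hΓ g).1 hg).1]
      simp [mul_assoc]
    · conv_rhs => rw [← ((hΓ g).1 hg).2 Y hY, ← ((hΓ h).1 hh).2 Y hY]
      simp [mul_assoc]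
  let B : (↥𝔤 ⧸ gβ) →ₗ[𝔽] (↥𝔤 ⧸ gβ) →ₗ[𝔽] 𝔽 := LinearMap.mk₂ 𝔽 ω
    (by
      rintro ⟨x⟩ ⟨y⟩ ⟨z⟩
      change ω (Submodule.Quotient.mk (x + y)) (Submodule.Quotient.mk z)
        = ω (Submodule.Quotient.mk x) (Submodule.Quotient.mk z)
          + ω (Submodule.Quotient.mk y) (Submodule.Quotient.mk z)
      simp only [hω, Submodule.coe_add, ← Matrix.trace_add]
      congr 1
      noncomm_ring)
    (by
      rintro c ⟨x⟩ ⟨y⟩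
      change ω (Submodule.Quotient.mk (c • x)) (Submodule.Quotient.mk y)
        = c • ω (Submodule.Quotient.mk x) (Submodule.Quotient.mk y)
      simp only [hω, Submodule.coe_smul, ← Matrix.trace_smul]
      congr 1
      simp [sub_mul, smul_sub])
    (by
      rintro ⟨x⟩ ⟨y⟩ ⟨z⟩
      change ω (Submodule.Quotient.mk x) (Submodule.Quotient.mk (y + z))
        = ω (Submodule.Quotient.mk x) (Submodule.Quotient.mk y)
          + ω (Submodule.Quotient.mk x) (Submodule.Quotient.mk z)
      simp only [hω, Submodule.coe_add, ← Matrix.trace_add]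
      congr 1
      noncomm_ring)
    (by
      rintro c ⟨x⟩ ⟨y⟩
      change ω (Submodule.Quotient.mk x) (Submodule.Quotient.mk (c • y))
        = c • ω (Submodule.Quotient.mk x) (Submodule.Quotient.mk y)
      simp only [hω, Submodule.coe_smul, ← Matrix.trace_smul]
      congr 1
      simp [sub_mul, smul_sub])
  have hBω : ∀ x y, ω x y = B x y := fun _ _ => rfl
  have hself : ∀ x, B x x = 0 := by
    rintro ⟨x⟩
    change ω (Submodule.Quotient.mk x) (Submodule.Quotient.mk x) = 0
    simp [hω]
  have hskew : ∀ x y, B x y = -B y x := by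
    intro x y
    have := hself (x + y)
    simp only [map_add, LinearMap.add_apply, hself, zero_add, add_zero] at this
    linear_combination this
  have hB : ∀ x, (∀ u, B u x = 0) → x = 0 := by
    rintro ⟨X⟩ hX
    refine (Submodule.Quotient.mk_eq_zero gβ).2 ((hgβ X).2 (sub_eq_zero.1 ?_))
    refine hnondeg _ (hbracket _ X.2 _ hβ) fun Y hY => ?_
    have h := hX (Submodule.Quotient.mk ⟨Y, hY⟩)
    change ω (Submodule.Quotient.mk _) (Submodule.Quotient.mk X) = 0 at h
    rw [hω] at h
    rw [← h]
    simp only [sub_mul, Matrix.trace_sub]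
    rw [Matrix.trace_mul_comm (_ * β) Y, Matrix.trace_mul_comm (β * _) Y,
      mul_assoc Y, mul_assoc (X : Matrix (Fin n) (Fin n) 𝔽) Y β,
      Matrix.trace_mul_comm (X : Matrix (Fin n) (Fin n) 𝔽), mul_assoc Y]
  have hsurj : ∀ g ∈ Γ, ∀ y, ∃ x, σ g x = y := by
    rintro g hg ⟨Y⟩
    obtain ⟨X, hX⟩ := hconj_surj g hg Y
    exact ⟨_, hσ g hg X Y hX⟩
  have hiso : ∀ g ∈ Γ, ∀ x y, B (σ g x) (σ g y) = B x y := by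
    rintro g hg ⟨x⟩ ⟨y⟩
    obtain ⟨x', hx'⟩ := hconj g hg x
    obtain ⟨y', hy'⟩ := hconj g hg y
    change ω (σ g (Submodule.Quotient.mk x)) (σ g (Submodule.Quotient.mk y))
      = ω (Submodule.Quotient.mk x) (Submodule.Quotient.mk y)
    rw [hσ g hg _ _ hx', hσ g hg _ _ hy', hω, hω, hx', hy']
    have hgβg : (↑g⁻¹ : Matrix (Fin n) (Fin n) 𝔽) * β * g = β :=
      hfix g hg ⟨β, hβ⟩ ((hgβ _).2 rfl)
    conv_lhs => rw [← hgβg]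
    have : ∀ M : Matrix (Fin n) (Fin n) 𝔽,
        ((↑g⁻¹ : Matrix (Fin n) (Fin n) 𝔽) * M * g).trace = M.trace := fun M => by
      rw [Matrix.trace_mul_comm, ← mul_assoc, Units.mul_inv, one_mul]
    rw [← this ((_ - _) * β)]
    congr 1
    simp [mul_assoc, sub_mul, mul_sub]
  have hcomp : ∀ g ∈ Γ, ∀ h ∈ Γ, ∀ u, σ (g * h) u = σ h (σ g u) := by
    rintro g hg h hh ⟨x⟩
    obtain ⟨y, hy⟩ := hconj g hg x
    obtain ⟨z, hz⟩ := hconj h hh y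
    change σ (g * h) (Submodule.Quotient.mk x) = σ h (σ g (Submodule.Quotient.mk x))
    rw [hσ g hg x y hy, hσ h hh y z hz]
    refine hσ _ (hmul g hg h hh) x z ?_
    rw [hz, hy]
    simp [mul_assoc]
  have hdefect : ∀ s : (↥𝔤 ⧸ gβ) →ₗ[𝔽] ↥𝔤,
      (∀ u : ↥𝔤 ⧸ gβ, (Submodule.Quotient.mk (s u) : ↥𝔤 ⧸ gβ) = u) → ∀ g ∈ Γ, ∀ u,
      ∃ d : ↥gβ, ((d : ↥𝔤) : Matrix (Fin n) (Fin n) 𝔽)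
        = (↑g⁻¹ : Matrix (Fin n) (Fin n) 𝔽) * (s u) * g
          - ((s (σ g u) : ↥𝔤) : Matrix (Fin n) (Fin n) 𝔽) := by
    intro s hs g hg u
    obtain ⟨y, hy⟩ := hconj g hg (s u)
    refine ⟨⟨y - s (σ g u), (Submodule.Quotient.eq gβ).1 ?_⟩, by simp [hy]⟩
    rw [hs, ← hσ g hg _ _ hy, hs]
  have hcocycle : ∀ s : (↥𝔤 ⧸ gβ) →ₗ[𝔽] ↥𝔤,
      (∀ u : ↥𝔤 ⧸ gβ, (Submodule.Quotient.mk (s u) : ↥𝔤 ⧸ gβ) = u) →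
      ∀ v : (Matrix (Fin n) (Fin n) 𝔽)ˣ → (↥𝔤 ⧸ gβ),
      (∀ g ∈ Γ, ∀ (u : ↥𝔤 ⧸ gβ) (d : ↥gβ),
        ((d : ↥𝔤) : Matrix (Fin n) (Fin n) 𝔽)
            = (↑g⁻¹ : Matrix (Fin n) (Fin n) 𝔽) * (s u) * g
              - ((s (σ g u) : ↥𝔤) : Matrix (Fin n) (Fin n) 𝔽) →
        ρ d = ψ₀ (ω u (v g))) →
      ∀ g ∈ Γ, ∀ h ∈ Γ, ∀ z, σ g z = v h → v (g * h) = v g + z := by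
    intro s hs v hv g hg h hh z hz
    refine eq_of_addChar_bilin_eq hψ₀ B hB fun u => ?_
    obtain ⟨d, hd⟩ := hdefect s hs g hg u
    obtain ⟨e, he⟩ := hdefect s hs h hh (σ g u)
    have hde : (((d + e : ↥gβ) : ↥𝔤) : Matrix (Fin n) (Fin n) 𝔽)
        = (↑(g * h)⁻¹ : Matrix (Fin n) (Fin n) 𝔽) * (s u)
            * ((g * h : (Matrix (Fin n) (Fin n) 𝔽)ˣ) : Matrix (Fin n) (Fin n) 𝔽)
          - ((s (σ (g * h) u) : ↥𝔤) : Matrix (Fin n) (Fin n) 𝔽) := by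
      rw [hcomp g hg h hh, Submodule.coe_add, Submodule.coe_add, he, ← hfix h hh d d.2, hd]
      simp only [mul_inv_rev, Units.val_mul]
      noncomm_ring
    rw [map_add (B u), AddChar.map_add_eq_mul, ← hiso g hg u z, hz, ← hBω, ← hBω, ← hBω,
      ← hv _ (hmul g hg h hh) u _ hde, ← hv g hg u d hd, ← hv h hh _ e he,
      AddChar.map_add_eq_mul]
  have ht : ∀ u, s' u - s u ∈ gβ := fun u => (Submodule.Quotient.eq gβ).1 (by rw [hs, hs'])
  have : Finite (↥𝔤 ⧸ gβ) := Finite.of_surjective _ (Submodule.Quotient.mk_surjective gβ)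
  let t : (↥𝔤 ⧸ gβ) →ₗ[𝔽] ↥gβ := (s' - s).codRestrict gβ ht
  have htval : ∀ u, ((t u : ↥𝔤) : Matrix (Fin n) (Fin n) 𝔽) = s' u - s u := fun _ => rfl
  obtain ⟨w, hw⟩ := exists_addChar_eq_bilin hψ₀ B hB (ρ.compAddMonoidHom t.toAddMonoidHom)
  replace hw : ∀ u, ρ (t u) = ψ₀ (B u w) := hw
  have hchange : ∀ g ∈ Γ, ∀ w₀, σ g w₀ = w → v' g = v g + w - w₀ := by
    intro g hg w₀ hw₀
    rw [eq_sub_iff_add_eq]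
    refine eq_of_addChar_bilin_eq hψ₀ B hB fun u => ?_
    obtain ⟨d, hd⟩ := hdefect s hs g hg u
    obtain ⟨d', hd'⟩ := hdefect s' hs' g hg u
    have hdd' : d' + t (σ g u) = d + t u := by
      refine Subtype.ext (Subtype.ext ?_)
      simp only [Submodule.coe_add]
      rw [← hfix g hg (t u) (t u).2, htval, htval, hd, hd']
      noncomm_ring
    rw [map_add (B u), map_add (B u), AddChar.map_add_eq_mul, AddChar.map_add_eq_mul, ← hiso g hg u w₀,
      hw₀, ← hw, ← hw, ← hBω, ← hBω, ← hv g hg u d hd, ← hv' g hg u d' hd',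
      ← AddChar.map_add_eq_mul, hdd', AddChar.map_add_eq_mul]
  refine ⟨fun g => ψ₀ ((2 : 𝔽)⁻¹ * (B (v g) w - B w (v' g) - B (v g) (v' g))),
    fun g hg h hh => ?_⟩
  obtain ⟨z, hz⟩ := hsurj g hg (v h)
  obtain ⟨z', hz'⟩ := hsurj g hg (v' h)
  obtain ⟨w₀, hw₀⟩ := hsurj g hg w
  have key := bilin_cocycle_change B hskew hself (hcocycle s hs v hv g hg h hh z hz)
    (hcocycle s' hs' v' hv' g hg h hh z' hz') (hchange g hg w₀ hw₀)
    (by rw [← hiso g hg, hz, hw₀]) (by rw [← hiso g hg, hz', hw₀])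
    (by rw [← hiso g hg, hz, hz'])
  rw [hBω, hBω, key, ← AddChar.map_neg_eq_inv, ← AddChar.map_add_eq_mul,
    ← AddChar.map_add_eq_mul, ← AddChar.map_add_eq_mul]
  congr 1
  ring
end
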